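/- arXiv:2406.07469 — 3 statements merged into one kernel-verified Lean document; each statement's English description precedes it below -/
import Mathlib

section
/- For all nonnegative integers n, p(5n+4) ≡ 0 (mod 5), where p is the partition function. -/
/-- The number of partitions of `n`. -/
noncomputable def partitionFn (n : ℕ) : ℕ := Fintype.card (Nat.Partition n)

/-- The rank of a partition: largest part minus number of parts. -/
def partitionRank {n : ℕ} (P : n.Partition) : ℤ :=
  (P.parts.sup : ℤ) - P.parts.card

/-- `N a b n`: number of partitions of `n` whose rank is congruent to `a` mod `b`. -/
noncomputable def rankCount (a b : ℤ) (n : ℕ) : ℕ :=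
  Fintype.card {P : n.Partition // partitionRank P % b = a % b}

/-- A recurrence for the products `ρ a * ρ b`, where `ρ (n + 1)` plays the role of
`1 / ∏ i ∈ range n, (1 - q ^ (i + 1))`. -/
theorem gaussian_reciprocal_recurrence {A : Type*} [CommRing A] (q : A) (ρ : ℕ → A)
    (hρ : ∀ k, ρ k = (1 - q ^ k) * ρ (k + 1)) (k b : ℕ) :
    (1 - q ^ (k + b + 1)) * (1 - q ^ (k + b + 2)) * (ρ (k + 2) * ρ (b + 2)) =
      (1 + q ^ (k + b + 1)) * (ρ (k + 1) * ρ (b + 1)) + q ^ (k + 1) * (ρ (k + 2) * ρ b) +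
        q ^ (b + 1) * (ρ k * ρ (b + 2)) := by
  rw [hρ k, hρ b, hρ (k + 1), hρ (b + 1)]
  ring

theorem jacobi_partial_sum {A : Type*} [CommRing A] (q : A) (ρ : ℕ → A) (h0 : ρ 0 = 0)
    (hρ : ∀ k, ρ k = (1 - q ^ k) * ρ (k + 1)) (n k : ℕ) (hk : k ≤ n + 1) :
    ∑ m ∈ Finset.range (k + 1), (-1) ^ m * (2 * m + 1 : A) * q ^ (m * (m + 1) / 2) *
      ((1 - q ^ (2 * n + 2)) * (1 - q ^ (2 * n + 3)) * (ρ (n + 2 - m) * ρ (n + m + 3)) -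
        (1 - q ^ (n + 1)) ^ 2 * (ρ (n + 1 - m) * ρ (n + m + 2))) =
      (-1) ^ k * q ^ (k * (k + 1) / 2) * (
        q ^ (n + 1) * (2 * k + 3) * (ρ (n + 1 - k) * ρ (n + k + 2)) +
        q ^ (n + k + 2) * (2 * k + 1) * (ρ (n - k) * ρ (n + k + 3))) := by
  induction k with
  | zero =>
    have := gaussian_reciprocal_recurrence q ρ hρ n (n + 1)
    simp
    rw [show 2 * n + 2 = n + (n + 1) + 1 by ring, show 2 * n + 3 = n + (n + 1) + 2 by ring, this]
    ring
  | succ k ih =>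
    rw [Finset.sum_range_succ, ih (by omega)]
    have ht : (k + 1) * (k + 1 + 1) / 2 = k * (k + 1) / 2 + (k + 1) := by
      rw [← Nat.add_mul_div_left _ _ (by simp)]
      ring_nf
    rw [ht]
    obtain ⟨l, rfl⟩ : ∃ l, n = k + l := ⟨n - k, by omega⟩
    cases l with
    | zero =>
      have h1 := hρ (2 * k + 2)
      have h2 := hρ (2 * k + 3)
      have e1 : k + 0 + 2 - (k + 1) = 1 := by omega
      have e2 : k + 0 + 1 - (k + 1) = 0 := by omega
      have e3 : k + 0 + 1 - k = 1 := by omega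
      have e4 : k + 0 - k = 0 := by omega
      have e5 : k + 0 - (k + 1) = 0 := by omega
      have e6 : k + 0 + (k + 1) + 3 = 2 * k + 4 := by omega
      have e7 : k + 0 + k + 2 = 2 * k + 2 := by omega
      rw [e1, e2, e3, e4, e5, e6, e7, h0, h1, h2]
      push_cast
      ring
    | succ l =>
      have := gaussian_reciprocal_recurrence q ρ hρ l (k + l + 1 + (k + 1) + 1)
      have e1 : k + (l + 1) + 2 - (k + 1) = l + 2 := by omega
      have e2 : k + (l + 1) + 1 - (k + 1) = l + 1 := by omega
      have e3 : k + (l + 1) + 1 - k = l + 2 := by omega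
      have e4 : k + (l + 1) - k = l + 1 := by omega
      have e5 : k + (l + 1) - (k + 1) = l := by omega
      rw [e1, e2, e3, e4, e5]
      have f1 : 2 * (k + (l + 1)) + 2 = l + (k + l + 1 + (k + 1) + 1) + 1 := by ring
      have f2 : 2 * (k + (l + 1)) + 3 = l + (k + l + 1 + (k + 1) + 1) + 2 := by ring
      have f3 : k + (l + 1) + (k + 1) + 3 = k + l + 1 + (k + 1) + 1 + 2 := by ring
      rw [f1, f2, f3, this]
      have f4 : k + (l + 1) + k + 3 = k + l + 1 + (k + 1) + 1 + 1 := by ring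
      have f5 : k + (l + 1) + k + 2 = k + l + 1 + (k + 1) + 1 := by ring
      have f6 : k + (l + 1) + (k + 1) + 2 = k + l + 1 + (k + 1) + 1 + 1 := by ring
      rw [f4, f5, f6]
      push_cast
      ring

/-- A finite form of Jacobi's identity for the cube of Euler's function. -/
theorem jacobi_cube_finite {A : Type*} [CommRing A] (q : A) (ρ : ℕ → A) (h0 : ρ 0 = 0) (h1 : ρ 1 = 1)
    (hρ : ∀ k, ρ k = (1 - q ^ k) * ρ (k + 1)) (n : ℕ) :
    (∏ i ∈ Finset.range (2 * n + 1), (1 - q ^ (i + 1))) *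
      ∑ m ∈ Finset.range (n + 1), (-1) ^ m * (2 * m + 1 : A) * q ^ (m * (m + 1) / 2) *
        (ρ (n + 1 - m) * ρ (n + m + 2)) =
      (∏ i ∈ Finset.range n, (1 - q ^ (i + 1))) ^ 2 := by
  induction n with
  | zero =>
    have := hρ 1
    rw [h1] at this
    simpa [h1] using this.symm
  | succ n ih =>
    have h := jacobi_partial_sum q ρ h0 hρ n (n + 1) le_rfl
    simp only [mul_sub, Finset.sum_sub_distrib] at h
    rw [Finset.sum_range_succ _ (n + 1), Finset.sum_range_succ _ (n + 1)] at h
    rw [show 2 * (n + 1) + 1 = 2 * n + 1 + 1 + 1 by ring, Finset.prod_range_succ,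
      Finset.prod_range_succ, Finset.prod_range_succ _ n, mul_pow, ← ih,
      Finset.sum_range_succ _ (n + 1)]
    simp only [Nat.sub_self, h0, Nat.sub_eq_zero_of_le (Nat.le_succ n)] at h
    have e (g : ℕ → A) (c : A) (s : ℕ → A) : ∑ m ∈ Finset.range (n + 1), s m * (c * g m) =
        c * ∑ m ∈ Finset.range (n + 1), s m * g m := by
      rw [Finset.mul_sum]
      exact Finset.sum_congr rfl fun _ _ ↦ by ring
    rw [e, e] at h
    simp only [show n + 1 + 1 = n + 2 from rfl, show ∀ m, n + 1 + m + 2 = n + m + 3 by intro; ring,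
      show 2 * n + 1 + 1 = 2 * n + 2 from rfl, show 2 * n + 2 + 1 = 2 * n + 3 from rfl] at h ⊢
    linear_combination (∏ i ∈ Finset.range (2 * n + 1), (1 - q ^ (i + 1))) * h

open PowerSeries in
theorem X_pow_dvd_prod_sub_prod (R : Type*) [CommRing R] {n m : ℕ} (h : n ≤ m) :
    (X : R⟦X⟧) ^ (n + 1) ∣ ∏ i ∈ Finset.range m, (1 - X ^ (i + 1)) -
      ∏ i ∈ Finset.range n, (1 - X ^ (i + 1)) := by
  induction m, h using Nat.le_induction with
  | base => simp
  | succ m h ih =>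
    rw [Finset.prod_range_succ, mul_sub, mul_one, sub_right_comm]
    exact ih.sub (Dvd.dvd.mul_left (pow_dvd_pow _ (by omega)) _)

open PowerSeries in
theorem X_pow_dvd_pentagonalSeries_sub_prod (R : Type*) [CommRing R] (n : ℕ) :
    (X : R⟦X⟧) ^ (n + 1) ∣ pentagonalSeries R - ∏ i ∈ Finset.range n, (1 - X ^ (i + 1)) := by
  rw [X_pow_dvd_iff]
  intro d hd
  obtain ⟨m, hm, hnm⟩ := ((Filter.tendsto_finset_range.eventually
    (coeff_prod_one_sub_X_pow_eventually_eq R d)).and (Filter.eventually_ge_atTop n)).exists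
  rw [map_sub, ← hm, ← map_sub]
  exact X_pow_dvd_iff.mp (X_pow_dvd_prod_sub_prod R hnm) d hd

open PowerSeries PowerSeries.WithPiTopology in
theorem pentagonalSeries_mul_mk_card_partition (R : Type*) [CommRing R] :
    pentagonalSeries R * PowerSeries.mk (fun n ↦ (Fintype.card n.Partition : R)) = 1 := by
  let _ : TopologicalSpace R := ⊥
  have _ : DiscreteTopology R := ⟨rfl⟩
  have h := (hasProd_one_sub_X_pow R).mul
    (Nat.Partition.hasProd_powerSeriesMk_card_restricted R fun _ ↦ True)
  have h' : (fun i : ℕ ↦ (1 - (X : R⟦X⟧) ^ (i + 1)) *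
      if True then ∑' j : ℕ, (X : R⟦X⟧) ^ ((i + 1) * j) else 1) = fun _ ↦ 1 := by
    funext i
    simp only [if_true, pow_mul]
    exact one_sub_mul_tsum_pow_of_constantCoeff_eq_zero (by simp)
  rw [h'] at h
  simpa [Nat.Partition.restricted] using h.unique hasProd_one

open PowerSeries in
/-- Jacobi's identity for the cube of Euler's function, modulo `X ^ (n + 1)`. -/
theorem X_pow_dvd_pentagonalSeries_cube_sub (F : Type*) [Field F] (n : ℕ) :
    (X : F⟦X⟧) ^ (n + 1) ∣ pentagonalSeries F ^ 3 -
      ∑ m ∈ Finset.range (n + 1), (-1) ^ m * (2 * m + 1 : F⟦X⟧) * X ^ (m * (m + 1) / 2) := by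
  set φ := pentagonalSeries F
  set P : F⟦X⟧ := PowerSeries.mk fun n ↦ (Fintype.card n.Partition : F)
  have hP : φ * P = 1 := pentagonalSeries_mul_mk_card_partition F
  set e : ℕ → F⟦X⟧ := fun n ↦ ∏ i ∈ Finset.range n, (1 - X ^ (i + 1)) with he
  have hφ (k : ℕ) : X ^ (k + 1) ∣ φ - e k := X_pow_dvd_pentagonalSeries_sub_prod F k
  have hinv (k : ℕ) : e k * (e k)⁻¹ = 1 := by
    refine PowerSeries.mul_inv_cancel _ ?_
    simp [he, map_prod]
  have hr (k : ℕ) : X ^ (k + 1) ∣ (e k)⁻¹ - P := by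
    have : (e k)⁻¹ - P = (φ - e k) * ((e k)⁻¹ * P) := by
      linear_combination P * hinv k - (e k)⁻¹ * hP
    exact this ▸ (hφ k).mul_right _
  let ρ : ℕ → F⟦X⟧ := fun k ↦ k.casesOn 0 fun k ↦ (e k)⁻¹
  have hρs (k : ℕ) : ρ (k + 1) = (e k)⁻¹ := rfl
  have hρ (k : ℕ) : ρ k = (1 - X ^ k) * ρ (k + 1) := by
    cases k with
    | zero => simp [ρ]
    | succ k =>
      have hs : e (k + 1) = e k * (1 - X ^ (k + 1)) := Finset.prod_range_succ ..
      rw [hρs, hρs]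
      linear_combination (-(e k)⁻¹) * hinv (k + 1) + (e (k + 1))⁻¹ * (1 - X ^ (k + 1)) * hinv k
        + (e k)⁻¹ * (e (k + 1))⁻¹ * hs
  have key := jacobi_cube_finite (X : F⟦X⟧) ρ rfl (by simp [ρ, he]) hρ n
  have hterm (m : ℕ) (hm : m ∈ Finset.range (n + 1)) : (X : F⟦X⟧) ^ (n + 1) ∣
      (-1) ^ m * (2 * m + 1 : F⟦X⟧) * X ^ (m * (m + 1) / 2) * (ρ (n + 1 - m) * ρ (n + m + 2)) -
        (-1) ^ m * (2 * m + 1 : F⟦X⟧) * X ^ (m * (m + 1) / 2) * (P * P) := by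
    have hm : m ≤ n := Finset.mem_range_succ_iff.mp hm
    obtain ⟨a, ha⟩ := hr (n - m)
    obtain ⟨b, hb⟩ := hr (n + m + 1)
    rw [show n + 1 - m = n - m + 1 by omega, hρs, hρs, sub_eq_iff_eq_add.mp ha,
      sub_eq_iff_eq_add.mp hb]
    have hT : m ≤ m * (m + 1) / 2 := by
      rw [Nat.le_div_iff_mul_le (by simp)]
      cases m <;> nlinarith
    obtain ⟨c, hc⟩ := Nat.exists_eq_add_of_le hT
    have : (X : F⟦X⟧) ^ (m * (m + 1) / 2) * X ^ (n - m + 1) = X ^ (n + 1) * X ^ c := by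
      rw [hc, ← pow_add, ← pow_add]
      congr 1
      omega
    refine ⟨(-1) ^ m * (2 * m + 1 : F⟦X⟧) * (X ^ c * a * (X ^ (n + m + 1 + 1) * b + P) +
      X ^ (m * (m + 1) / 2) * X ^ (m + 1) * P * b), ?_⟩
    have h2 : (X : F⟦X⟧) ^ (n + m + 1 + 1) = X ^ (n + 1) * X ^ (m + 1) := by ring
    rw [h2]
    linear_combination (-1) ^ m * (2 * m + 1 : F⟦X⟧) * a * (X ^ (n + 1) * X ^ (m + 1) * b + P) * this
  have hsum := Finset.dvd_sum hterm
  rw [Finset.sum_sub_distrib, ← Finset.sum_mul] at hsum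
  set S := ∑ m ∈ Finset.range (n + 1),
    (-1) ^ m * (2 * m + 1 : F⟦X⟧) * (X : F⟦X⟧) ^ (m * (m + 1) / 2) * (ρ (n + 1 - m) * ρ (n + m + 2))
  set J := ∑ m ∈ Finset.range (n + 1),
    (-1) ^ m * (2 * m + 1 : F⟦X⟧) * (X : F⟦X⟧) ^ (m * (m + 1) / 2)
  change e (2 * n + 1) * S = e n ^ 2 at key
  have hlong : X ^ (n + 1) ∣ φ - e (2 * n + 1) := (pow_dvd_pow _ (by omega)).trans (hφ _)
  have : φ ^ 3 - J = φ * (φ + e n) * (φ - e n) - φ * S * (φ - e (2 * n + 1))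
      + φ ^ 2 * (S - J * (P * P)) := by
    linear_combination (-φ) * key + J * (φ * P + 1) * hP
  rw [this]
  exact (((hφ n).mul_left _).sub (hlong.mul_left _)).add (hsum.mul_left _)

open PowerSeries in
theorem coeff_pentagonalSeries_cube_eq_zero {d : ℕ} (hd : d % 5 ≠ 0 ∧ d % 5 ≠ 1) :
    (pentagonalSeries (ZMod 5) ^ 3).coeff d = 0 := by
  have : Fact (Nat.Prime 5) := ⟨by norm_num⟩
  have h := X_pow_dvd_iff.mp (X_pow_dvd_pentagonalSeries_cube_sub (ZMod 5) d) d (by omega)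
  rw [map_sub, sub_eq_zero] at h
  rw [h, map_sum]
  refine Finset.sum_eq_zero fun m _ ↦ ?_
  have hC : (-1) ^ m * (2 * m + 1 : (ZMod 5)⟦X⟧) = C (R := ZMod 5) ((-1) ^ m * ((2 * m + 1 : ℕ) : ZMod 5)) := by
    rw [map_mul, map_natCast, map_pow, map_neg, map_one]
    push_cast
    rfl
  rw [hC, coeff_C_mul, coeff_X_pow]
  split_ifs with hdm
  · have hm : 2 * d = m * (m + 1) := by
      rw [hdm, Nat.mul_div_cancel' (Nat.even_mul_succ_self m).two_dvd]
    have h5 : (2 * m + 1) % 5 = 0 := by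
      have : 2 * d % 5 = m % 5 * (m % 5 + 1) % 5 := by
        have hmod : m % 5 ≡ m [MOD 5] := Nat.mod_modEq m 5
        rw [hm]
        exact (hmod.mul (hmod.add_right 1)).symm
      have h1 : m % 5 < 5 := Nat.mod_lt _ (by norm_num)
      generalize hr : m % 5 = r at *
      interval_cases r <;> omega
    rw [(ZMod.natCast_eq_zero_iff _ _).mpr (Nat.dvd_of_mod_eq_zero h5)]
    simp
  · simp

theorem pentagonal_mod_five_le (k : ℤ) : pentagonal k % 5 ≤ 2 := by
  have h : (2 * (pentagonal k : ℤ)) % 5 = (k % 5) * (3 * (k % 5) - 1) % 5 := by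
    rw [two_mul_natCast_pentagonal]
    have hk : k % 5 ≡ k [ZMOD 5] := Int.mod_modEq k 5
    exact (hk.mul ((hk.mul_left 3).sub_right 1)).symm
  have h1 : 0 ≤ k % 5 := Int.emod_nonneg _ (by norm_num)
  have h2 : k % 5 < 5 := Int.emod_lt_of_pos _ (by norm_num)
  generalize hr : k % 5 = r at *
  interval_cases r <;> omega

open PowerSeries in
theorem coeff_pentagonalSeries_pow_four_eq_zero {d : ℕ} (hd : d % 5 = 4) :
    (pentagonalSeries (ZMod 5) ^ 4).coeff d = 0 := by
  rw [pow_succ, coeff_mul]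
  refine Finset.sum_eq_zero fun ⟨a, b⟩ hab ↦ ?_
  have hab : a + b = d := Finset.HasAntidiagonal.mem_antidiagonal.mp hab
  by_cases hb : b ∈ Set.range pentagonal
  · obtain ⟨k, rfl⟩ := hb
    have := pentagonal_mod_five_le k
    rw [coeff_pentagonalSeries_cube_eq_zero (by omega), zero_mul]
  · rw [coeff_pentagonalSeries_eq_zero _ hb, mul_zero]

open PowerSeries in
theorem coeff_pow_five_eq_zero (f : (ZMod 5)⟦X⟧) {d : ℕ} (hd : ¬ 5 ∣ d) :
    (f ^ 5).coeff d = 0 := by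
  have : Fact (Nat.Prime 5) := ⟨by norm_num⟩
  have h : map (frobenius (ZMod 5) 5) (expand 5 (by norm_num) f) = f ^ 5 :=
    MvPowerSeries.map_frobenius_expand 5 (by norm_num)
  rw [← h, coeff_map, coeff_expand_of_not_dvd _ _ _ hd, map_zero]

theorem ramanujan_mod_five (n : ℕ) : partitionFn (5 * n + 4) % 5 = 0 := by
  set φ := PowerSeries.pentagonalSeries (ZMod 5)
  set P : PowerSeries (ZMod 5) := .mk fun n ↦ (Fintype.card n.Partition : ZMod 5) with hPdef
  have hP : φ * P = 1 := pentagonalSeries_mul_mk_card_partition (ZMod 5)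
  have hfac : P = φ ^ 4 * P ^ 5 := by
    rw [pow_succ P, ← mul_assoc, ← mul_pow, hP, one_pow, one_mul]
  have hcoeff : P.coeff (5 * n + 4) = 0 := by
    rw [hfac, PowerSeries.coeff_mul]
    refine Finset.sum_eq_zero fun ⟨a, b⟩ hab ↦ ?_
    have hab : a + b = 5 * n + 4 := Finset.HasAntidiagonal.mem_antidiagonal.mp hab
    by_cases hb : 5 ∣ b
    · rw [coeff_pentagonalSeries_pow_four_eq_zero (by omega), zero_mul]
    · rw [coeff_pow_five_eq_zero P hb, mul_zero]
  rw [hPdef, PowerSeries.coeff_mk, ZMod.natCast_eq_zero_iff] at hcoeff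
  exact Nat.mod_eq_zero_of_dvd hcoeff
end

section
/- For all nonnegative integers n, p(7n+5) ≡ 0 (mod 7), where p is the partition function. -/
open PowerSeries Finset

section Jacobi

variable {R : Type*} [CommRing R]

/-- The finite Euler product `(q; q)_n = ∏_{i = 1}^n (1 - q ^ i)`. -/
def eulerProd (q : R) (n : ℕ) : R := ∏ i ∈ range n, (1 - q ^ (i + 1))

lemma eulerProd_zero (q : R) : eulerProd q 0 = 1 := by simp [eulerProd]

lemma eulerProd_succ (q : R) (n : ℕ) :
    eulerProd q (n + 1) = eulerProd q n * (1 - q ^ (n + 1)) := prod_range_succ _ _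

/-- The coefficients `(-1) ^ k * q ^ (k * (k + 1) / 2) * [2 * n + 1, n - k]_q` (Gaussian binomial)
of the finite form of Jacobi's identity, defined through their recurrence in `n`. -/
def jacobiCoeff (q : R) : ℕ → ℕ → R
  | 0, 0 => 1
  | 0, _ + 1 => 0
  | n + 1, 0 => (1 + q ^ (2 * n + 2)) * jacobiCoeff q n 0
      - q ^ (n + 1) * (jacobiCoeff q n 1 - jacobiCoeff q n 0)
  | n + 1, k + 1 => (1 + q ^ (2 * n + 2)) * jacobiCoeff q n (k + 1)
      - q ^ (n + 1) * (jacobiCoeff q n k + jacobiCoeff q n (k + 2))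

lemma jacobiCoeff_eq_zero (q : R) {n k : ℕ} (h : n < k) : jacobiCoeff q n k = 0 := by
  induction n generalizing k with
  | zero =>
    obtain ⟨k, rfl⟩ := Nat.exists_eq_succ_of_ne_zero h.ne'
    simp [jacobiCoeff]
  | succ n ih =>
    obtain ⟨k, rfl⟩ := Nat.exists_eq_succ_of_ne_zero (Nat.ne_zero_of_lt h)
    simp [jacobiCoeff, ih (show n < k by omega), ih (show n < k + 1 by omega),
      ih (show n < k + 2 by omega)]

lemma sum_jacobiCoeff_succ (q : R) (n m : ℕ) :
    ∑ k ∈ range (m + 1), (2 * k + 1 : R) * jacobiCoeff q (n + 1) k =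
      (1 - q ^ (n + 1)) ^ 2 * ∑ k ∈ range (m + 1), (2 * k + 1 : R) * jacobiCoeff q n k +
      q ^ (n + 1) * ((2 * m + 3) * jacobiCoeff q n m - (2 * m + 1) * jacobiCoeff q n (m + 1)) := by
  induction m with
  | zero =>
    simp [jacobiCoeff]
    ring
  | succ m ih =>
    rw [sum_range_succ, ih, sum_range_succ _ (m + 1), jacobiCoeff]
    push_cast
    ring

/-- Finite form of Jacobi's identity for the cube of the Euler product. -/
lemma sum_jacobiCoeff (q : R) (n : ℕ) :
    ∑ k ∈ range (n + 1), (2 * k + 1 : R) * jacobiCoeff q n k = eulerProd q n ^ 2 := by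
  induction n with
  | zero => simp [jacobiCoeff, eulerProd]
  | succ n ih =>
    rw [sum_jacobiCoeff_succ, sum_range_succ, ih, eulerProd_succ,
      jacobiCoeff_eq_zero q (show n < n + 1 by omega),
      jacobiCoeff_eq_zero q (show n < n + 1 + 1 by omega)]
    ring

lemma choose_two_succ (k : ℕ) : (k + 2).choose 2 = (k + 1).choose 2 + (k + 1) := by
  rw [Nat.choose_succ_succ' (k + 1) 1, Nat.choose_one_right, add_comm]

lemma jacobiCoeff_mul_eulerProd (q : R) (k d : ℕ) :
    jacobiCoeff q (k + d) k * (eulerProd q d * eulerProd q (2 * k + d + 1)) =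
      (-1) ^ k * q ^ (k + 1).choose 2 * eulerProd q (2 * (k + d) + 1) := by
  obtain ⟨n, hn⟩ : ∃ n, n = k + d := ⟨_, rfl⟩
  induction n generalizing k d with
  | zero =>
    obtain ⟨rfl, rfl⟩ : k = 0 ∧ d = 0 := by omega
    simp [jacobiCoeff, eulerProd]
  | succ n ih =>
    have upper (j e : ℕ) (h : n + 1 = j + e) :
        jacobiCoeff q n j * (eulerProd q e * eulerProd q (2 * j + e + 1)) =
          (-1) ^ j * q ^ (j + 1).choose 2 * eulerProd q (2 * n + 1) * (1 - q ^ e)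
            * (1 - q ^ (2 * j + e + 1)) := by
      rcases e with _ | e
      · simp [jacobiCoeff_eq_zero q (show n < j by omega)]
      · obtain rfl : n = j + e := by omega
        rw [← ih j e rfl, eulerProd_succ q e, show 2 * j + (e + 1) + 1 = (2 * j + e + 1) + 1 by ring,
          eulerProd_succ q (2 * j + e + 1)]
        ring
    have next (j e : ℕ) (h : n + 1 = j + e) :
        jacobiCoeff q n (j + 1) * (eulerProd q e * eulerProd q (2 * j + e + 1)) =
          (-1) ^ (j + 1) * q ^ (j + 2).choose 2 * eulerProd q (2 * n + 1) * (1 - q ^ e)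
            * (1 - q ^ (e - 1)) := by
      rcases e with _ | e
      · simp [jacobiCoeff_eq_zero q (show n < j + 1 by omega)]
      · rcases e with _ | e
        · simp [jacobiCoeff_eq_zero q (show n < j + 1 by omega)]
        · obtain rfl : n = j + 1 + e := by omega
          have := ih (j + 1) e rfl
          rw [show 2 * j + (e + 1 + 1) + 1 = 2 * (j + 1) + e + 1 by ring, eulerProd_succ q (e + 1),
            eulerProd_succ q e]
          simp only [Nat.add_sub_cancel]
          linear_combination (1 - q ^ (e + 1 + 1)) * (1 - q ^ (e + 1)) * this
    have hP : eulerProd q (2 * (n + 1) + 1) =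
        eulerProd q (2 * n + 1) * (1 - q ^ (2 * n + 2)) * (1 - q ^ (2 * n + 3)) := by
      rw [show 2 * (n + 1) + 1 = 2 * n + 1 + 1 + 1 by ring, eulerProd_succ, eulerProd_succ]
    rw [← hn, hP]
    rcases k with _ | k
    · obtain rfl : d = n + 1 := by omega
      have h₀ := upper 0 (n + 1) (by omega)
      have h₁ := next 0 (n + 1) (by omega)
      simp [jacobiCoeff] at h₀ h₁ ⊢
      linear_combination (1 + q ^ (2 * n + 2) + q ^ (n + 1)) * h₀ - q ^ (n + 1) * h₁
    · obtain rfl : n = k + d := by omega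
      have h₀ := upper (k + 1) d (by omega)
      have h₁ := next (k + 1) d (by omega)
      have h₂ := ih k d rfl
      have h₃ : eulerProd q (2 * (k + 1) + d + 1) = eulerProd q (2 * k + d + 1) *
          (1 - q ^ (2 * k + d + 2)) * (1 - q ^ (2 * k + d + 3)) := by
        rw [show 2 * (k + 1) + d + 1 = 2 * k + d + 1 + 1 + 1 by ring, eulerProd_succ,
          eulerProd_succ]
      rw [choose_two_succ (k + 1)] at h₁
      rw [choose_two_succ k] at h₀ h₁ ⊢
      rw [jacobiCoeff]
      rw [h₃] at h₀ h₁ ⊢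
      rcases d with _ | d
      · simp only [jacobiCoeff_eq_zero q (show k + 0 < k + 1 by omega),
          jacobiCoeff_eq_zero q (show k + 0 < k + 2 by omega)]
        linear_combination (- q ^ (k + 1)) * (1 - q ^ (2 * k + 2)) * (1 - q ^ (2 * k + 3)) * h₂
      · simp only [Nat.add_sub_cancel] at h₁
        linear_combination (1 + q ^ (2 * (k + (d + 1)) + 2)) * h₀ - q ^ (k + (d + 1) + 1) * h₁
          - q ^ (k + (d + 1) + 1) * (1 - q ^ (2 * k + (d + 1) + 2))
            * (1 - q ^ (2 * k + (d + 1) + 3)) * h₂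

end Jacobi

section Series

variable {R : Type*} [CommRing R]

lemma isUnit_eulerProd (n : ℕ) : IsUnit (eulerProd (X : R⟦X⟧) n) := by
  simp [PowerSeries.isUnit_iff_constantCoeff, eulerProd]

lemma X_pow_dvd_eulerProd_sub {m n : ℕ} (h : m ≤ n) :
    (X : R⟦X⟧) ^ (m + 1) ∣ eulerProd X n - eulerProd X m := by
  induction n, h using Nat.le_induction with
  | base => simp
  | succ n hn ih =>
    rw [eulerProd_succ, show eulerProd (X : R⟦X⟧) n * (1 - X ^ (n + 1)) - eulerProd X m =
      (eulerProd X n - eulerProd X m) - eulerProd X n * X ^ (n + 1) by ring]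
    exact dvd_sub ih (Dvd.dvd.mul_left (pow_dvd_pow _ (by omega)) _)

/-- **Jacobi's identity** for the cube of the Euler product, up to order `n`. -/
lemma X_pow_dvd_eulerProd_cube_sub (n : ℕ) :
    (X : R⟦X⟧) ^ (n + 1) ∣ eulerProd X n ^ 3 -
      ∑ k ∈ range (n + 1), (2 * k + 1 : R⟦X⟧) * ((-1) ^ k * X ^ (k + 1).choose 2) := by
  rw [pow_succ (eulerProd X n), ← sum_jacobiCoeff, sum_mul, ← sum_sub_distrib]
  refine dvd_sum fun k hk ↦ ?_
  obtain ⟨d, rfl⟩ := Nat.exists_eq_add_of_le (Nat.lt_succ_iff.mp (mem_range.mp hk))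
  rw [mul_assoc, ← mul_sub]
  refine Dvd.dvd.mul_left ?_ _
  have key := jacobiCoeff_mul_eulerProd (X : R⟦X⟧) k d
  obtain ⟨c, hc⟩ : (X : R⟦X⟧) ^ (k + 1).choose 2 ∣ jacobiCoeff X (k + d) k := by
    rw [← ((isUnit_eulerProd d).mul (isUnit_eulerProd (2 * k + d + 1))).dvd_mul_right, key]
    exact (dvd_mul_left _ _).mul_right _
  have hk : k ≤ (k + 1).choose 2 := by
    rw [Nat.choose_succ_succ' k 1, Nat.choose_one_right]
    omega
  rw [← (isUnit_eulerProd (2 * k + d + 1)).dvd_mul_right]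
  have h₁ := X_pow_dvd_eulerProd_sub (R := R) (show d ≤ k + d by omega)
  have h₂ := X_pow_dvd_eulerProd_sub (R := R) (show 2 * k + d + 1 ≤ 2 * (k + d) + 1 by omega)
  have h₃ : (X : R⟦X⟧) ^ (k + d + 1) ∣
      X ^ (k + 1).choose 2 * (eulerProd X (k + d) - eulerProd X d) :=
    (pow_dvd_pow _ (by omega)).trans ((pow_add X ((k + 1).choose 2) (d + 1)).dvd.trans
      (mul_dvd_mul_left _ h₁))
  have h₄ := (pow_dvd_pow (X : R⟦X⟧) (show k + d + 1 ≤ 2 * k + d + 1 + 1 by omega)).trans h₂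
  rw [hc] at key ⊢
  convert! dvd_add (h₃.mul_left (c * eulerProd X (2 * k + d + 1)))
    (h₄.mul_left ((-1) ^ k * X ^ (k + 1).choose 2)) using 1
  linear_combination key

open PowerSeries.WithPiTopology in
/-- The partition generating function inverts the Euler product, up to order `n`. -/
lemma X_pow_dvd_partition_mul_eulerProd_sub_one [NoZeroDivisors R] (n : ℕ) :
    (X : R⟦X⟧) ^ (n + 1) ∣ PowerSeries.mk (fun m ↦ (partitionFn m : R)) * eulerProd X n - 1 := by
  nontriviality R
  let _ : TopologicalSpace R := ⊥
  have _ : DiscreteTopology R := ⟨rfl⟩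
  have hg : PowerSeries.mk (fun m ↦ (partitionFn m : R)) * pentagonalSeries R = 1 := by
    have h := (Nat.Partition.hasProd_powerSeriesMk_card_restricted R (fun _ ↦ True)).mul
      (hasProd_one_sub_X_pow R)
    simp_rw [if_true, pow_mul,
      fun i : ℕ ↦ tsum_pow_mul_one_sub_of_constantCoeff_eq_zero (R := R)
        (f := X ^ (i + 1)) (by simp)] at h
    simpa [Nat.Partition.restricted, partitionFn] using h.unique hasProd_one
  have hE : (X : R⟦X⟧) ^ (n + 1) ∣ pentagonalSeries R - eulerProd X n := by
    rw [X_pow_dvd_iff]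
    intro m hm
    obtain ⟨s, hs⟩ := Filter.eventually_atTop.mp (coeff_prod_one_sub_X_pow_eventually_eq R m)
    obtain ⟨N, hN⟩ := s.exists_nat_subset_range
    have h := X_pow_dvd_iff.mp (X_pow_dvd_eulerProd_sub (R := R) (le_max_right N n)) m hm
    rw [map_sub, ← hs (range (max N n)) (hN.trans (by simp))]
    simpa [eulerProd] using h
  convert! (hE.mul_left (PowerSeries.mk (fun m ↦ (partitionFn m : R)))).neg_right using 1
  linear_combination hg

end Series

instance : Fact (Nat.Prime 7) := ⟨by norm_num⟩

lemma eulerProd_pow_seven (n : ℕ) :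
    eulerProd (X : (ZMod 7)⟦X⟧) n ^ 7 = expand 7 (by norm_num) (eulerProd X n) := by
  have : CharP (ZMod 7)⟦X⟧ 7 := charP_of_injective_algebraMap (R := ZMod 7)
    (algebraMap (ZMod 7) (ZMod 7)⟦X⟧).injective 7
  simp only [eulerProd, map_prod, map_sub, map_one, map_pow, expand_X, ← prod_pow]
  refine prod_congr rfl fun i _ ↦ ?_
  rw [sub_pow_char, one_pow, ← pow_mul, ← pow_mul, mul_comm]

lemma eight_mul_choose_two_add_one (k : ℕ) : 8 * (k + 1).choose 2 + 1 = (2 * k + 1) ^ 2 := by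
  induction k with
  | zero => rfl
  | succ k ih => rw [choose_two_succ]; linarith

lemma odd_mul_odd_eq_zero {a b m : ℕ} (h : 7 * m + 5 = (a + 1).choose 2 + (b + 1).choose 2) :
    (2 * a + 1 : ZMod 7) * (2 * b + 1) = 0 := by
  have hsq : (2 * a + 1 : ZMod 7) ^ 2 + (2 * b + 1) ^ 2 = 0 := by
    have : (2 * a + 1) ^ 2 + (2 * b + 1) ^ 2 = 7 * (8 * m + 6) := by
      rw [← eight_mul_choose_two_add_one, ← eight_mul_choose_two_add_one]
      omega
    have := congrArg (Nat.cast (R := ZMod 7)) this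
    push_cast at this
    rw [this, show (7 : ZMod 7) = 0 from rfl, zero_mul]
  exact (by decide : ∀ x y : ZMod 7, x ^ 2 + y ^ 2 = 0 → x * y = 0) _ _ hsq

lemma coeff_jacobi_sq (n m : ℕ) :
    coeff (7 * m + 5) ((∑ k ∈ range n,
      (2 * k + 1 : (ZMod 7)⟦X⟧) * ((-1) ^ k * X ^ (k + 1).choose 2)) ^ 2) = 0 := by
  rw [sq, sum_mul_sum, map_sum]
  refine sum_eq_zero fun a _ ↦ ?_
  rw [map_sum]
  refine sum_eq_zero fun b _ ↦ ?_
  have : (2 * a + 1 : (ZMod 7)⟦X⟧) * ((-1) ^ a * X ^ (a + 1).choose 2) *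
      ((2 * b + 1 : (ZMod 7)⟦X⟧) * ((-1) ^ b * X ^ (b + 1).choose 2)) =
      C ((2 * a + 1 : ZMod 7) * (2 * b + 1) * (-1) ^ (a + b)) *
        X ^ ((a + 1).choose 2 + (b + 1).choose 2) := by
    simp only [map_mul, map_add, map_pow, map_neg, map_one, map_natCast, map_ofNat]
    ring
  rw [this, coeff_C_mul, coeff_X_pow]
  split_ifs with h
  · rw [odd_mul_odd_eq_zero h, zero_mul, zero_mul]
  · rw [mul_zero]

lemma coeff_partition_mul_eulerProd_pow_seven (m : ℕ) :
    coeff (7 * m + 5) (PowerSeries.mk (fun i ↦ (partitionFn i : ZMod 7)) *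
      eulerProd X (7 * m + 5) ^ 7) = 0 := by
  set g := PowerSeries.mk (fun i ↦ (partitionFn i : ZMod 7))
  set P := eulerProd (X : (ZMod 7)⟦X⟧) (7 * m + 5)
  have h₁ : X ^ (7 * m + 5 + 1) ∣ g * P - 1 := X_pow_dvd_partition_mul_eulerProd_sub_one _
  have h₂ := X_pow_dvd_eulerProd_cube_sub (R := ZMod 7) (7 * m + 5)
  have h₃ := coeff_jacobi_sq (7 * m + 5 + 1) m
  set J := ∑ k ∈ range (7 * m + 5 + 1),
    (2 * k + 1 : (ZMod 7)⟦X⟧) * ((-1) ^ k * X ^ (k + 1).choose 2)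
  have h : X ^ (7 * m + 5 + 1) ∣ g * P ^ 7 - J ^ 2 := by
    convert! dvd_add (h₁.mul_right (P ^ 6)) (h₂.mul_right (P ^ 3 + J)) using 1
    ring
  simpa [h₃] using X_pow_dvd_iff.mp h (7 * m + 5) (by omega)

lemma partitionFn_cast_eq_zero (m : ℕ) : (partitionFn (7 * m + 5) : ZMod 7) = 0 := by
  induction m using Nat.strong_induction_on with
  | _ m ih =>
    have h := coeff_partition_mul_eulerProd_pow_seven m
    rw [eulerProd_pow_seven, coeff_mul, sum_eq_single (7 * m + 5, 0)] at h
    · simpa [eulerProd] using h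
    · rintro ⟨i, j⟩ hij hne
      rw [HasAntidiagonal.mem_antidiagonal] at hij
      by_cases hj : 7 ∣ j
      · obtain ⟨j, rfl⟩ := hj
        obtain ⟨l, rfl⟩ : ∃ l, i = 7 * l + 5 := ⟨m - j, by simp at hij; omega⟩
        have hl : l < m := by
          by_contra hl
          exact hne (by simp at hij ⊢; omega)
        simp [ih l hl]
      · simp [coeff_expand_of_not_dvd _ _ _ hj]
    · simp

theorem ramanujan_mod_seven (n : ℕ) : partitionFn (7 * n + 5) % 7 = 0 :=
  Nat.mod_eq_zero_of_dvd ((ZMod.natCast_eq_zero_iff _ _).mp (partitionFn_cast_eq_zero n))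
end

section
/- For all nonnegative integers n, N(1,5;5n+1) = N(2,5;5n+1). -/
/-! ### Summability of lattice sums -/

lemma norm_neg_one_zpow (n : ℤ) : ‖(-1 : ℂ) ^ n‖ = 1 := by
  rw [norm_zpow, norm_neg, norm_one, one_zpow]

lemma neg_one_zpow_mul_self (n : ℤ) : (-1 : ℂ) ^ n * (-1) ^ n = 1 := by
  rw [← mul_zpow]; simp

lemma neg_one_zpow_two_mul (n : ℤ) : (-1 : ℂ) ^ (2 * n) = 1 := by
  rw [zpow_mul]; norm_num

lemma neg_one_zpow_neg (n : ℤ) : (-1 : ℂ) ^ (-n) = (-1) ^ n := by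
  rw [zpow_neg, eq_comm]
  exact eq_inv_of_mul_eq_one_left (neg_one_zpow_mul_self n)

lemma summable_pow_natAbs {ρ : ℝ} (h0 : 0 ≤ ρ) (h1 : ρ < 1) :
    Summable fun n : ℤ => ρ ^ n.natAbs := by
  apply Summable.of_nat_of_neg <;> simpa using summable_geometric_of_lt_one h0 h1

/-- The standing assumption on the variable. -/
structure SmallNome (x : ℂ) : Prop where
  ne_zero : x ≠ 0
  norm_lt : ‖x‖ < 1 / 4

namespace SmallNome

variable {x : ℂ}

lemma norm_pos (hx : SmallNome x) : 0 < ‖x‖ := norm_pos_iff.mpr hx.ne_zero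

lemma norm_lt_one (hx : SmallNome x) : ‖x‖ < 1 := hx.norm_lt.trans (by norm_num)

lemma norm_zpow_le (hx : SmallNome x) {e C : ℤ} {N : ℕ} (h : (N : ℤ) ≤ e + C) :
    ‖x ^ e‖ ≤ ‖x‖ ^ (-C) * ‖x‖ ^ N := by
  rw [norm_zpow, ← zpow_natCast, ← zpow_add₀ hx.norm_pos.ne']
  exact zpow_le_zpow_right_of_le_one₀ hx.norm_pos hx.norm_lt_one.le (by omega)

lemma zpow_ne_one (hx : SmallNome x) {n : ℤ} (hn : n ≠ 0) : x ^ n ≠ 1 := by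
  intro h
  have h1 : ‖x‖ ^ n = 1 := by rw [← norm_zpow, h, norm_one]
  rcases zpow_eq_one_iff_cases₀.mp h1 with h2 | h2 | h2
  · exact hn h2
  · exact hx.norm_lt_one.ne h2
  · linarith [hx.norm_pos, h2.1]

/-- The denominators of the Lambert series are bounded below. -/
lemma norm_inv_one_sub_zpow_le (hx : SmallNome x) (n : ℤ) : ‖(1 - x ^ n)⁻¹‖ ≤ 2 := by
  rcases lt_trichotomy n 0 with h | rfl | h
  · have h1 : (4 : ℝ) ≤ ‖x ^ n‖ := by
      rw [norm_zpow]
      calc (4 : ℝ) ≤ ‖x‖ ^ (-1 : ℤ) := by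
            rw [zpow_neg_one, le_inv_comm₀ (by norm_num) hx.norm_pos]
            have := hx.norm_lt; norm_num at this ⊢; linarith
        _ ≤ ‖x‖ ^ n := zpow_le_zpow_right_of_le_one₀ hx.norm_pos hx.norm_lt_one.le (by omega)
    have h2 : ‖x ^ n‖ - ‖(1 : ℂ)‖ ≤ ‖x ^ n - 1‖ := norm_sub_norm_le _ _
    rw [norm_sub_rev, norm_one] at h2
    rw [norm_inv, inv_le_comm₀ (by linarith) (by norm_num)]
    linarith
  · simp
  · have h1 : ‖x ^ n‖ ≤ 1 / 4 := by
      rw [norm_zpow]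
      calc ‖x‖ ^ n ≤ ‖x‖ ^ (1 : ℤ) :=
            zpow_le_zpow_right_of_le_one₀ hx.norm_pos hx.norm_lt_one.le (by omega)
        _ ≤ 1 / 4 := by rw [zpow_one]; exact hx.norm_lt.le
    have h2 : ‖(1 : ℂ)‖ - ‖x ^ n‖ ≤ ‖1 - x ^ n‖ := norm_sub_norm_le _ _
    rw [norm_one] at h2
    rw [norm_inv, inv_le_comm₀ (by linarith) (by norm_num)]
    linarith

lemma summable_norm_of_bound (hx : SmallNome x) {f : ℤ → ℂ} (K : ℝ)
    (h : ∀ n, ‖f n‖ ≤ K * ‖x‖ ^ n.natAbs) : Summable fun n => ‖f n‖ :=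
  Summable.of_nonneg_of_le (fun _ => norm_nonneg _) h
    ((summable_pow_natAbs (norm_nonneg x) hx.norm_lt_one).mul_left K)

lemma summable_norm_zpow (hx : SmallNome x) {e : ℤ → ℤ} (C : ℤ)
    (h : ∀ n : ℤ, |n| ≤ e n + C) : Summable fun n => ‖x ^ e n‖ :=
  hx.summable_norm_of_bound _ fun n => hx.norm_zpow_le (by simpa using h n)

lemma summable_norm_sign_zpow (hx : SmallNome x) {e : ℤ → ℤ} (C : ℤ)
    (h : ∀ n : ℤ, |n| ≤ e n + C) : Summable fun n => ‖(-1 : ℂ) ^ n * x ^ e n‖ := by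
  simpa [norm_mul, norm_neg_one_zpow] using hx.summable_norm_zpow C h

lemma natAbs_mul_norm_pow_le (hx : SmallNome x) (N : ℕ) : (N : ℝ) * ‖x‖ ^ N ≤ 1 := by
  have h1 : ‖x‖ ^ N ≤ (1 / 4) ^ N := pow_le_pow_left₀ hx.norm_pos.le hx.norm_lt.le N
  have h2 : (N : ℝ) ≤ 4 ^ N := by exact_mod_cast (Nat.lt_pow_self (by norm_num)).le
  calc (N : ℝ) * ‖x‖ ^ N ≤ 4 ^ N * (1 / 4) ^ N := by gcongr
    _ = 1 := by rw [← mul_pow]; norm_num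

lemma summable_norm_mul_zpow (hx : SmallNome x) {e : ℤ → ℤ} (C : ℤ)
    (h : ∀ n : ℤ, 2 * |n| ≤ e n + C) : Summable fun n : ℤ => ‖(n : ℂ) * x ^ e n‖ := by
  refine hx.summable_norm_of_bound (‖x‖ ^ (-C)) fun n => ?_
  have h1 := hx.norm_zpow_le (e := e n) (C := C) (N := n.natAbs + n.natAbs)
    (by have := h n; push_cast; linarith)
  have h2 : ‖(n : ℂ)‖ = (n.natAbs : ℝ) := by rw [Complex.norm_intCast, Nat.cast_natAbs]; simp
  have h3 := hx.natAbs_mul_norm_pow_le n.natAbs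
  have h4 : 0 < ‖x‖ ^ (-C) := zpow_pos hx.norm_pos _
  rw [norm_mul, h2]
  calc (n.natAbs : ℝ) * ‖x ^ e n‖
      ≤ n.natAbs * (‖x‖ ^ (-C) * ‖x‖ ^ (n.natAbs + n.natAbs)) := by gcongr
    _ = ‖x‖ ^ (-C) * ‖x‖ ^ n.natAbs * (n.natAbs * ‖x‖ ^ n.natAbs) := by rw [pow_add]; ring
    _ ≤ ‖x‖ ^ (-C) * ‖x‖ ^ n.natAbs * 1 := by gcongr
    _ = _ := mul_one _

lemma summable_norm_mul_sign_zpow (hx : SmallNome x) {e : ℤ → ℤ} (C : ℤ)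
    (h : ∀ n : ℤ, 2 * |n| ≤ e n + C) :
    Summable fun n : ℤ => ‖(n : ℂ) * ((-1) ^ n * x ^ e n)‖ := by
  simpa [norm_mul, norm_neg_one_zpow] using hx.summable_norm_mul_zpow C h

/-- A series with leading term `1` and rapidly decreasing remaining terms does not vanish. -/
lemma tsum_sign_zpow_ne_zero (hx : SmallNome x) {e : ℤ → ℤ} (h0 : e 0 = 0)
    (h : ∀ n : ℤ, |n| ≤ e n) : ∑' n : ℤ, (-1 : ℂ) ^ n * x ^ e n ≠ 0 := by
  have hs := hx.summable_norm_sign_zpow (e := e) 0 (by simpa using h)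
  rw [hs.of_norm.tsum_eq_add_tsum_ite 0]
  simp only [zpow_zero, h0, mul_one]
  intro hz
  have hρ : Summable fun n : ℤ => if n = 0 then (0 : ℝ) else ‖x‖ ^ n.natAbs :=
    (summable_pow_natAbs hx.norm_pos.le hx.norm_lt_one).of_nonneg_of_le
      (fun n => by split_ifs <;> positivity) (fun n => by split_ifs <;> simp)
  have hb : ‖∑' n : ℤ, if n = 0 then 0 else (-1 : ℂ) ^ n * x ^ e n‖
      ≤ ∑' n : ℤ, if n = 0 then (0 : ℝ) else ‖x‖ ^ n.natAbs := by
    refine tsum_of_norm_bounded hρ.hasSum fun n => ?_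
    split_ifs
    · simp
    · have := hx.norm_zpow_le (e := e n) (C := 0) (N := n.natAbs) (by simpa using h n)
      simpa [norm_mul, norm_neg_one_zpow] using this
  have hg := summable_geometric_of_lt_one hx.norm_pos.le hx.norm_lt_one
  have hv : HasSum (fun n : ℤ => if n = 0 then (0 : ℝ) else ‖x‖ ^ n.natAbs)
      (‖x‖ * (1 - ‖x‖)⁻¹ + ‖x‖ * (1 - ‖x‖)⁻¹) := by
    have h1 : HasSum (fun n : ℕ => ‖x‖ ^ (n + 1)) (‖x‖ * (1 - ‖x‖)⁻¹) := by
      simpa [pow_succ'] using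
        (hasSum_geometric_of_lt_one hx.norm_pos.le hx.norm_lt_one).mul_left ‖x‖
    have h2 := HasSum.of_add_one_of_neg_add_one
      (f := fun n : ℤ => if n = 0 then (0 : ℝ) else ‖x‖ ^ n.natAbs)
      (m := ‖x‖ * (1 - ‖x‖)⁻¹) (m' := ‖x‖ * (1 - ‖x‖)⁻¹)
      (by
        convert h1 using 2 with n
        rw [if_neg (by omega)]; congr 1)
      (by
        convert h1 using 2 with n
        rw [if_neg (by omega)]; congr 1)
    simpa using h2
  rw [hv.tsum_eq] at hb
  have h3 : ‖∑' n : ℤ, if n = 0 then 0 else (-1 : ℂ) ^ n * x ^ e n‖ = 1 := by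
    rw [← norm_neg, ← eq_neg_of_add_eq_zero_left hz, norm_one]
  rw [h3] at hb
  have h4 : ‖x‖ * (1 - ‖x‖)⁻¹ ≤ 1 / 3 := by
    rw [← div_eq_mul_inv, div_le_iff₀ (by linarith [hx.norm_lt_one])]
    linarith [hx.norm_lt]
  linarith

end SmallNome

/-! ### Theta functions of level five -/

/-- The theta series attached to the residue class of `a` modulo `5`. -/
noncomputable def theta (x : ℂ) (a : ℤ) : ℂ :=
  ∑' n : ℤ, (-1) ^ n * x ^ ((5 * n + a) * (5 * n + a - 5))

/-- The theta series `theta x a` with its terms weighted by the summation index. -/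
noncomputable def thetaDeriv (x : ℂ) (a : ℤ) : ℂ :=
  ∑' n : ℤ, (n : ℂ) * ((-1) ^ n * x ^ ((5 * n + a) * (5 * n + a - 5)))

lemma theta_add_five (x : ℂ) (a : ℤ) : theta x (a + 5) = -theta x a := by
  rw [theta, theta, ← tsum_neg, ← (Equiv.subRight (1 : ℤ)).tsum_eq]
  refine tsum_congr fun n => ?_
  rw [Equiv.subRight_apply, zpow_sub_one₀ (by norm_num)]
  ring_nf

lemma theta_five_sub (x : ℂ) (a : ℤ) : theta x (5 - a) = theta x a := by
  rw [theta, theta, ← (Equiv.neg ℤ).tsum_eq]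
  refine tsum_congr fun n => ?_
  rw [Equiv.neg_apply, neg_one_zpow_neg]
  ring_nf

lemma theta_zero (x : ℂ) : theta x 0 = 0 := by
  have h1 := theta_add_five x 0
  have h2 := theta_five_sub x 0
  rw [zero_add] at h1
  rw [sub_zero, h1] at h2
  exact self_eq_neg.mp h2.symm

lemma theta_sub_five_mul (x : ℂ) (a m : ℤ) : theta x (a - 5 * m) = (-1) ^ m * theta x a := by
  induction m using Int.induction_on with
  | zero => simp
  | succ i ih =>
    have h := theta_add_five x (a - 5 * (i + 1))
    rw [show a - 5 * ((i : ℤ) + 1) + 5 = a - 5 * i by ring, ih] at h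
    rw [zpow_add_one₀ (by norm_num)]
    linear_combination h
  | pred i ih =>
    have h := theta_add_five x (a - 5 * (-i))
    rw [show a - 5 * (-(i : ℤ)) + 5 = a - 5 * (-i - 1) by ring, ih] at h
    rw [h, zpow_sub_one₀ (by norm_num)]
    ring

lemma theta_three (x : ℂ) : theta x 3 = theta x 2 := theta_five_sub x 2

lemma theta_four (x : ℂ) : theta x 4 = theta x 1 := theta_five_sub x 1

lemma theta_neg (x : ℂ) (a : ℤ) : theta x (-a) = -theta x a := by
  have h := theta_add_five x (-a)
  rw [show -a + 5 = 5 - a by ring, theta_five_sub] at h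
  rw [h, neg_neg]

lemma thetaDeriv_five_sub (x : ℂ) (a : ℤ) : thetaDeriv x (5 - a) = -thetaDeriv x a := by
  rw [thetaDeriv, thetaDeriv, ← (Equiv.neg ℤ).tsum_eq, ← tsum_neg]
  refine tsum_congr fun n => ?_
  rw [Equiv.neg_apply, neg_one_zpow_neg]
  push_cast
  ring_nf

namespace SmallNome

variable {x : ℂ}

lemma two_abs_le_exponent (a n : ℤ) :
    2 * |n| ≤ (5 * n + a) * (5 * n + a - 5) + (2 * |a| + 25) := by
  rcases abs_cases n with ⟨h, h'⟩ | ⟨h, h'⟩ <;> rcases abs_cases a with ⟨g, g'⟩ | ⟨g, g'⟩ <;>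
    rw [h, g] <;> nlinarith [sq_nonneg (5 * n + a - 3), sq_nonneg (5 * n + a - 2)]

lemma summable_theta (hx : SmallNome x) (a : ℤ) :
    Summable fun n : ℤ => ‖(-1 : ℂ) ^ n * x ^ ((5 * n + a) * (5 * n + a - 5))‖ :=
  hx.summable_norm_sign_zpow (2 * |a| + 25) fun n => by
    linarith [two_abs_le_exponent a n, abs_nonneg n]

lemma summable_thetaDeriv (hx : SmallNome x) (a : ℤ) :
    Summable fun n : ℤ => ‖(n : ℂ) * ((-1) ^ n * x ^ ((5 * n + a) * (5 * n + a - 5)))‖ :=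
  hx.summable_norm_mul_sign_zpow _ (two_abs_le_exponent a)

lemma thetaDeriv_add_five (hx : SmallNome x) (a : ℤ) :
    thetaDeriv x (a + 5) = theta x a - thetaDeriv x a := by
  rw [theta, thetaDeriv, thetaDeriv,
    ← (hx.summable_theta a).of_norm.tsum_sub (hx.summable_thetaDeriv a).of_norm,
    ← (Equiv.subRight (1 : ℤ)).tsum_eq]
  refine tsum_congr fun n => ?_
  rw [Equiv.subRight_apply, zpow_sub_one₀ (by norm_num)]
  push_cast
  ring_nf

lemma theta_ne_zero (hx : SmallNome x) {a : ℤ} (ha : 0 < a) (ha' : a < 5) : theta x a ≠ 0 := by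
  have h : theta x a = x ^ (a * (a - 5)) *
      ∑' n : ℤ, (-1) ^ n * x ^ (25 * n * n + (10 * a - 25) * n) := by
    rw [theta, ← tsum_mul_left]
    refine tsum_congr fun n => ?_
    rw [mul_left_comm, ← zpow_add₀ hx.ne_zero]
    ring_nf
  rw [h]
  refine mul_ne_zero (zpow_ne_zero _ hx.ne_zero) (hx.tsum_sign_zpow_ne_zero (by ring) fun n => ?_)
  rcases lt_trichotomy n 0 with hn | rfl | hn
  · rw [abs_of_neg hn]; nlinarith
  · simp
  · rw [abs_of_pos hn]; nlinarith

end SmallNome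

/-! ### Sums over planar lattices -/

/-- Splitting `ℤ × ℤ` according to the parity of the sum of the coordinates. -/
def paritySplit : (ℤ × ℤ) ⊕ (ℤ × ℤ) ≃ ℤ × ℤ where
  toFun := Sum.elim (fun p => (p.1 + p.2, p.1 - p.2)) (fun p => (p.1 + p.2, p.1 + 1 - p.2))
  invFun p := if (p.1 + p.2) % 2 = 0 then .inl ((p.1 + p.2) / 2, (p.1 - p.2) / 2)
    else .inr ((p.1 + p.2) / 2, (p.1 - p.2 + 1) / 2)
  left_inv p := by
    rcases p with ⟨s, t⟩ | ⟨s, t⟩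
    · refine (if_pos (by simp only [Sum.elim_inl]; omega)).trans ?_
      simp only [Sum.elim_inl, Sum.inl.injEq, Prod.mk.injEq]
      omega
    · refine (if_neg (by simp only [Sum.elim_inr]; omega)).trans ?_
      simp only [Sum.elim_inr, Sum.inr.injEq, Prod.mk.injEq]
      omega
  right_inv p := by
    rcases p with ⟨m, n⟩
    dsimp only
    split_ifs with h <;> simp only [Sum.elim_inl, Sum.elim_inr, Prod.mk.injEq] <;> omega

lemma tsum_paritySplit {f : ℤ × ℤ → ℂ} (hf : Summable f) :
    ∑' p, f p = ∑' p : ℤ × ℤ, f (p.1 + p.2, p.1 - p.2)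
      + ∑' p : ℤ × ℤ, f (p.1 + p.2, p.1 + 1 - p.2) := by
  have h := paritySplit.summable_iff.mpr hf
  have h1 : Summable ((f ∘ paritySplit) ∘ Sum.inl) := h.comp_injective Sum.inl_injective
  have h2 : Summable ((f ∘ paritySplit) ∘ Sum.inr) := h.comp_injective Sum.inr_injective
  rw [← paritySplit.tsum_eq f]
  exact (h1.hasSum.sum h2.hasSum).tsum_eq

/-- An affine unimodular change of variables in a sum over `ℤ × ℤ`. -/
lemma tsum_eq_of_inverse {f g : ℤ × ℤ → ℂ} (φ ψ : ℤ × ℤ → ℤ × ℤ)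
    (h1 : Function.LeftInverse ψ φ) (h2 : Function.RightInverse ψ φ)
    (h : ∀ p, f (φ p) = g p) : ∑' p, f p = ∑' p, g p := by
  rw [← (Equiv.mk φ ψ h1 h2).tsum_eq f]
  exact tsum_congr h

/-! ### Bilinear relations between theta series -/

/-- The even part of the series governing products of two theta series. -/
noncomputable def evenTheta (x : ℂ) (a : ℤ) : ℂ := ∑' s : ℤ, x ^ (2 * (5 * s + a) ^ 2)

/-- The odd part of the series governing products of two theta series. -/
noncomputable def oddTheta (x : ℂ) (a : ℤ) : ℂ :=
  ∑' s : ℤ, x ^ (2 * (5 * s + a) ^ 2 - 10 * (5 * s + a))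

namespace SmallNome

variable {x : ℂ}

lemma two_abs_le_even_exponent (a n : ℤ) :
    2 * |n| ≤ 2 * (5 * n + a) ^ 2 + (2 * |a| + 25) := by
  rcases abs_cases n with ⟨h, h'⟩ | ⟨h, h'⟩ <;> rcases abs_cases a with ⟨g, g'⟩ | ⟨g, g'⟩ <;>
    rw [h, g] <;> nlinarith [sq_nonneg (5 * n + a - 1), sq_nonneg (5 * n + a + 1)]

lemma two_abs_le_odd_exponent (a n : ℤ) :
    2 * |n| ≤ 2 * (5 * n + a) ^ 2 - 10 * (5 * n + a) + (2 * |a| + 50) := by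
  rcases abs_cases n with ⟨h, h'⟩ | ⟨h, h'⟩ <;> rcases abs_cases a with ⟨g, g'⟩ | ⟨g, g'⟩ <;>
    rw [h, g] <;> nlinarith [sq_nonneg (5 * n + a - 3), sq_nonneg (5 * n + a - 2)]

lemma summable_evenTheta (hx : SmallNome x) (a : ℤ) :
    Summable fun s : ℤ => ‖x ^ (2 * (5 * s + a) ^ 2)‖ :=
  hx.summable_norm_zpow (2 * |a| + 25) fun n => by
    linarith [two_abs_le_even_exponent a n, abs_nonneg n]

lemma summable_oddTheta (hx : SmallNome x) (a : ℤ) :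
    Summable fun s : ℤ => ‖x ^ (2 * (5 * s + a) ^ 2 - 10 * (5 * s + a))‖ :=
  hx.summable_norm_zpow (2 * |a| + 50) fun n => by
    linarith [two_abs_le_odd_exponent a n, abs_nonneg n]

lemma tsum_weighted_theta_mul (hx : SmallNome x) (c : ℤ → ℂ) (a t : ℤ)
    (hs : Summable fun p : ℤ × ℤ => c (p.1 + p.2) *
      (((-1) ^ p.1 * x ^ ((5 * p.1 + (t + a)) * (5 * p.1 + (t + a) - 5))) *
        ((-1) ^ p.2 * x ^ ((5 * p.2 + (t - a)) * (5 * p.2 + (t - a) - 5)))))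
    (he : Summable fun s : ℤ => ‖c (2 * s) * x ^ (2 * (5 * s + t) ^ 2 - 10 * (5 * s + t))‖)
    (ho : Summable fun s : ℤ => ‖c (2 * s + 1) * x ^ (2 * (5 * s + t) ^ 2)‖) :
    ∑' p : ℤ × ℤ, c (p.1 + p.2) *
      (((-1) ^ p.1 * x ^ ((5 * p.1 + (t + a)) * (5 * p.1 + (t + a) - 5))) *
        ((-1) ^ p.2 * x ^ ((5 * p.2 + (t - a)) * (5 * p.2 + (t - a) - 5))))
      = evenTheta x a * ∑' s, c (2 * s) * x ^ (2 * (5 * s + t) ^ 2 - 10 * (5 * s + t))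
        - oddTheta x a * ∑' s, c (2 * s + 1) * x ^ (2 * (5 * s + t) ^ 2) := by
  rw [tsum_paritySplit hs, evenTheta, oddTheta, mul_comm (∑' s : ℤ, x ^ _) (∑' _, _),
    mul_comm (∑' s : ℤ, x ^ _) (∑' _, _),
    tsum_mul_tsum_of_summable_norm he (hx.summable_evenTheta a),
    tsum_mul_tsum_of_summable_norm ho (hx.summable_oddTheta a),
    sub_eq_add_neg (∑' _ : ℤ × ℤ, _), ← tsum_neg]
  have hm : ∀ u v e f : ℤ, (-1 : ℂ) ^ u * x ^ e * ((-1) ^ v * x ^ f)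
      = (-1) ^ (u + v) * x ^ (e + f) := fun u v e f => by
    rw [zpow_add₀ (by norm_num), zpow_add₀ hx.ne_zero]; ring
  congr 1 <;> refine tsum_congr fun p => ?_
  all_goals dsimp only
  · rw [hm, mul_assoc, ← zpow_add₀ hx.ne_zero,
      show p.1 + p.2 + (p.1 - p.2) = 2 * p.1 by ring, neg_one_zpow_two_mul, one_mul]
    congr 2; ring
  · rw [hm, mul_assoc, ← zpow_add₀ hx.ne_zero,
      show p.1 + p.2 + (p.1 + 1 - p.2) = 2 * p.1 + 1 by ring, zpow_add_one₀ (by norm_num),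
      neg_one_zpow_two_mul, one_mul, neg_one_mul, mul_neg]
    congr 3; ring

lemma theta_mul_theta (hx : SmallNome x) (a t : ℤ) :
    theta x (t + a) * theta x (t - a)
      = evenTheta x a * oddTheta x t - oddTheta x a * evenTheta x t := by
  have h := hx.tsum_weighted_theta_mul (fun _ => 1) a t
    (by simpa using summable_mul_of_summable_norm (hx.summable_theta _) (hx.summable_theta _))
    (by simpa using hx.summable_oddTheta t) (by simpa using hx.summable_evenTheta t)
  simp only [one_mul] at h
  rw [theta, theta, tsum_mul_tsum_of_summable_norm (hx.summable_theta _) (hx.summable_theta _), h]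
  rfl

lemma thetaDeriv_mul_theta_add (hx : SmallNome x) (a t : ℤ) :
    thetaDeriv x (t + a) * theta x (t - a) + theta x (t + a) * thetaDeriv x (t - a)
      = evenTheta x a *
          ∑' s : ℤ, (2 * s : ℂ) * x ^ (2 * (5 * s + t) ^ 2 - 10 * (5 * s + t))
        - oddTheta x a * ∑' s : ℤ, (2 * s + 1 : ℂ) * x ^ (2 * (5 * s + t) ^ 2) := by
  have h1 := summable_mul_of_summable_norm (hx.summable_thetaDeriv (t + a))
    (hx.summable_theta (t - a))
  have h2 := summable_mul_of_summable_norm (hx.summable_theta (t + a))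
    (hx.summable_thetaDeriv (t - a))
  have he : Summable fun s : ℤ =>
      ‖(2 * s : ℂ) * x ^ (2 * (5 * s + t) ^ 2 - 10 * (5 * s + t))‖ := by
    simpa [norm_mul, mul_assoc] using
      (hx.summable_norm_mul_zpow _ (two_abs_le_odd_exponent t)).mul_left 2
  have ho : Summable fun s : ℤ => ‖(2 * s + 1 : ℂ) * x ^ (2 * (5 * s + t) ^ 2)‖ := by
    refine Summable.of_nonneg_of_le (fun _ => norm_nonneg _) (fun s => ?_)
      (((hx.summable_norm_mul_zpow _ (two_abs_le_even_exponent t)).mul_left 2).add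
        (hx.summable_evenTheta t))
    rw [add_mul, one_mul, mul_assoc]
    refine (norm_add_le _ _).trans ?_
    rw [norm_mul]
    simp
  have h := hx.tsum_weighted_theta_mul (fun n => (n : ℂ)) a t
    (by
      refine (h1.add h2).congr fun p => ?_
      push_cast; ring)
    (by simpa using he) (by simpa using ho)
  push_cast at h
  rw [← h, thetaDeriv, theta, theta, thetaDeriv,
    tsum_mul_tsum_of_summable_norm (hx.summable_thetaDeriv _) (hx.summable_theta _),
    tsum_mul_tsum_of_summable_norm (hx.summable_theta _) (hx.summable_thetaDeriv _),
    ← h1.tsum_add h2]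
  refine tsum_congr fun p => ?_
  ring

lemma thetaDeriv_neg_one (hx : SmallNome x) :
    thetaDeriv x (-1) = thetaDeriv x 1 - theta x 1 := by
  have h1 := hx.thetaDeriv_add_five (-1)
  have h2 := thetaDeriv_five_sub x 1
  have h3 := theta_neg x 1
  norm_num at h1 h2 h3
  rw [h2, h3] at h1
  linear_combination h1

lemma thetaDeriv_zero_mul_theta_one_pow (hx : SmallNome x) :
    thetaDeriv x 0 * theta x 1 ^ 3
      = thetaDeriv x 1 * theta x 2 ^ 3 - 3 * theta x 1 * theta x 2 ^ 2 * thetaDeriv x 2 := by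
  have h01 := hx.theta_mul_theta 0 1
  have h02 := hx.theta_mul_theta 0 2
  have h12 := hx.theta_mul_theta 1 2
  have d0 := hx.thetaDeriv_mul_theta_add 0 2
  have d1 := hx.thetaDeriv_mul_theta_add 1 2
  have d2 := hx.thetaDeriv_mul_theta_add 2 2
  have e3 := thetaDeriv_five_sub x 2
  norm_num at h01 h02 h12 d0 d1 d2 e3
  rw [theta_three] at h12 d1
  rw [theta_four, theta_zero] at d2
  rw [e3] at d1
  generalize (∑' s : ℤ, (2 * s : ℂ) * x ^ (2 * (5 * s + 2) ^ 2 - 10 * (5 * s + 2))) = u at *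
  generalize (∑' s : ℤ, (2 * s + 1 : ℂ) * x ^ (2 * (5 * s + 2) ^ 2)) = v at *
  linear_combination theta x 1 ^ 2 * d2 - theta x 2 ^ 2 * d1 + theta x 2 * theta x 1 * d0
    + (evenTheta x 2 * u - oddTheta x 2 * v) * h01 - (evenTheta x 1 * u - oddTheta x 1 * v) * h02
    + (evenTheta x 0 * u - oddTheta x 0 * v) * h12

lemma thetaDeriv_zero_mul_theta_two_pow (hx : SmallNome x) :
    thetaDeriv x 0 * theta x 2 ^ 3
      = 3 * theta x 1 ^ 2 * thetaDeriv x 1 * theta x 2 + theta x 1 ^ 3 * thetaDeriv x 2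
        - theta x 1 ^ 3 * theta x 2 := by
  have h01 := hx.theta_mul_theta 0 1
  have h02 := hx.theta_mul_theta 0 2
  have h12 := hx.theta_mul_theta 1 2
  have d0 := hx.thetaDeriv_mul_theta_add 0 1
  have d1 := hx.thetaDeriv_mul_theta_add 1 1
  have d2 := hx.thetaDeriv_mul_theta_add 2 1
  have e3 := thetaDeriv_five_sub x 2
  have t1 := theta_neg x 1
  norm_num at h01 h02 h12 d0 d1 d2 e3
  rw [theta_three] at h12 d2
  rw [theta_zero] at d1
  rw [e3, t1, hx.thetaDeriv_neg_one] at d2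
  generalize (∑' s : ℤ, (2 * s : ℂ) * x ^ (2 * (5 * s + 1) ^ 2 - 10 * (5 * s + 1))) = u at *
  generalize (∑' s : ℤ, (2 * s + 1 : ℂ) * x ^ (2 * (5 * s + 1) ^ 2)) = v at *
  linear_combination -theta x 1 ^ 2 * d2 + theta x 2 ^ 2 * d1 - theta x 2 * theta x 1 * d0
    - (evenTheta x 2 * u - oddTheta x 2 * v) * h01 + (evenTheta x 1 * u - oddTheta x 1 * v) * h02
    - (evenTheta x 0 * u - oddTheta x 0 * v) * h12

end SmallNome

/-! ### The dissection of Euler's product -/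

/-- The part of Euler's pentagonal series indexed by the residue class of `j` modulo `5`. -/
noncomputable def eulerPart (x : ℂ) (j : ℤ) : ℂ :=
  ∑' m : ℤ, (-1) ^ (5 * m + j) * x ^ (3 * (5 * m + j) ^ 2 + (5 * m + j))

/-- The exponents in the product of `eulerPart x j` and `theta x a`. -/
def quintExp (j a m n : ℤ) : ℤ :=
  3 * (5 * m + j) ^ 2 + (5 * m + j) + (5 * n + a) * (5 * n + a - 5)

/-- The terms of even index sum in the product of `eulerPart x j` and `theta x a`. -/
noncomputable def quintEven (x : ℂ) (j a : ℤ) : ℂ :=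
  ∑' p : ℤ × ℤ, x ^ quintExp j a (p.1 + p.2) (p.1 - p.2)

/-- The terms of odd index sum in the product of `eulerPart x j` and `theta x a`. -/
noncomputable def quintOdd (x : ℂ) (j a : ℤ) : ℂ :=
  ∑' p : ℤ × ℤ, x ^ quintExp j a (p.1 + p.2) (p.1 + 1 - p.2)

namespace SmallNome

variable {x : ℂ}

lemma summable_pentagonal (hx : SmallNome x) :
    Summable fun k : ℤ => ‖(-1 : ℂ) ^ k * x ^ (3 * k ^ 2 + k)‖ :=
  hx.summable_norm_sign_zpow 2 fun k => by
    rcases abs_cases k with ⟨h, h'⟩ | ⟨h, h'⟩ <;> rw [h] <;> nlinarith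

lemma injective_five_mul_add (j : ℤ) : Function.Injective fun m : ℤ => 5 * m + j :=
  fun a b h => by simpa using h

lemma summable_eulerPart (hx : SmallNome x) (j : ℤ) :
    Summable fun m : ℤ => ‖(-1 : ℂ) ^ (5 * m + j) * x ^ (3 * (5 * m + j) ^ 2 + (5 * m + j))‖ :=
  hx.summable_pentagonal.comp_injective (injective_five_mul_add j)

lemma eulerPart_mul_theta (hx : SmallNome x) (j a : ℤ) :
    eulerPart x j * theta x a = (-1) ^ j * (quintEven x j a - quintOdd x j a) := by
  rw [eulerPart, theta,
    tsum_mul_tsum_of_summable_norm (hx.summable_eulerPart j) (hx.summable_theta a),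
    tsum_paritySplit
      (summable_mul_of_summable_norm (hx.summable_eulerPart j) (hx.summable_theta a)),
    quintEven, quintOdd, sub_eq_add_neg, ← tsum_neg, mul_add, ← tsum_mul_left, ← tsum_mul_left]
  have hm : ∀ u v e f : ℤ, (-1 : ℂ) ^ (5 * u + j) * x ^ e * ((-1) ^ v * x ^ f)
      = (-1) ^ (u + v) * ((-1) ^ j * x ^ (e + f)) := fun u v e f => by
    rw [zpow_add₀ (by norm_num), zpow_add₀ (by norm_num), zpow_add₀ hx.ne_zero, zpow_mul]
    norm_num
    ring
  congr 1 <;> refine tsum_congr fun p => ?_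
  all_goals dsimp only
  · rw [hm, show p.1 + p.2 + (p.1 - p.2) = 2 * p.1 by ring, neg_one_zpow_two_mul, one_mul]
    rfl
  · rw [hm, show p.1 + p.2 + (p.1 + 1 - p.2) = 2 * p.1 + 1 by ring, zpow_add_one₀ (by norm_num),
      neg_one_zpow_two_mul, one_mul, neg_one_mul, mul_neg]
    rfl

lemma eulerPart_zero_add_three_mul_theta_one (hx : SmallNome x) :
    (eulerPart x 0 + eulerPart x 3) * theta x 1 = -(eulerPart x 4 * theta x 2) := by
  have h1 : quintEven x 0 1 = quintOdd x 4 2 :=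
    tsum_eq_of_inverse (fun p => (p.1 + 1, -p.1 - p.2 - 1)) (fun p => (p.1 - 1, -p.1 - p.2))
      (fun p => by ext <;> grind) (fun p => by ext <;> grind)
      (fun p => by simp only [quintExp]; congr 1; ring)
  have h2 : quintOdd x 0 1 = quintOdd x 3 1 :=
    tsum_eq_of_inverse (fun p => (-p.1 - p.2 - 1, p.1 + 1)) (fun p => (p.2 - 1, -p.1 - p.2))
      (fun p => by ext <;> grind) (fun p => by ext <;> grind)
      (fun p => by simp only [quintExp]; congr 1; ring)
  have h3 : quintEven x 3 1 = quintEven x 4 2 :=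
    tsum_eq_of_inverse (fun p => (-p.1 - p.2 - 1, p.2)) (fun p => (-p.1 - p.2 - 1, p.2))
      (fun p => by ext <;> grind) (fun p => by ext <;> grind)
      (fun p => by simp only [quintExp]; congr 1; ring)
  rw [add_mul, hx.eulerPart_mul_theta, hx.eulerPart_mul_theta, hx.eulerPart_mul_theta, h1, h2, h3,
    zpow_zero, (by norm_num : (-1 : ℂ) ^ (3 : ℤ) = -1), (by norm_num : (-1 : ℂ) ^ (4 : ℤ) = 1)]
  ring

lemma eulerPart_one_add_two_mul_theta_two (hx : SmallNome x) :
    (eulerPart x 1 + eulerPart x 2) * theta x 2 = eulerPart x 4 * theta x 1 := by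
  have h1 : quintEven x 1 2 = quintOdd x 4 1 :=
    tsum_eq_of_inverse (fun p => (p.2, -p.1 - p.2 - 1)) (fun p => (-p.1 - p.2 - 1, p.1))
      (fun p => by ext <;> grind) (fun p => by ext <;> grind)
      (fun p => by simp only [quintExp]; congr 1; ring)
  have h2 : quintOdd x 1 2 = quintOdd x 2 2 :=
    tsum_eq_of_inverse (fun p => (-p.1 - p.2 - 1, p.1 + 1)) (fun p => (p.2 - 1, -p.1 - p.2))
      (fun p => by ext <;> grind) (fun p => by ext <;> grind)
      (fun p => by simp only [quintExp]; congr 1; ring)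
  have h3 : quintEven x 2 2 = quintEven x 4 1 :=
    tsum_eq_of_inverse (fun p => (-p.1 - p.2 - 1, p.1)) (fun p => (p.2, -p.1 - p.2 - 1))
      (fun p => by ext <;> grind) (fun p => by ext <;> grind)
      (fun p => by simp only [quintExp]; congr 1; ring)
  rw [add_mul, hx.eulerPart_mul_theta, hx.eulerPart_mul_theta, hx.eulerPart_mul_theta, h1, h2, h3,
    zpow_one, (by norm_num : (-1 : ℂ) ^ (2 : ℤ) = 1), (by norm_num : (-1 : ℂ) ^ (4 : ℤ) = 1)]
  ring

lemma eulerPart_four_ne_zero (hx : SmallNome x) : eulerPart x 4 ≠ 0 := by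
  have h : eulerPart x 4 = -x ^ (2 : ℤ) *
      ∑' n : ℤ, (-1) ^ n * x ^ (75 * n * n - 25 * n) := by
    rw [eulerPart, ← tsum_mul_left, ← (Equiv.subRight (1 : ℤ)).tsum_eq]
    refine tsum_congr fun n => ?_
    rw [Equiv.subRight_apply, show 5 * (n - 1) + 4 = 5 * n - 1 by ring,
      zpow_sub_one₀ (by norm_num), zpow_mul, mul_left_comm, neg_mul, ← zpow_add₀ hx.ne_zero]
    rw [(by norm_num : (-1 : ℂ) ^ (5 : ℤ) = -1)]
    ring_nf
  rw [h]
  refine mul_ne_zero (neg_ne_zero.mpr (zpow_ne_zero _ hx.ne_zero))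
    (hx.tsum_sign_zpow_ne_zero (by ring) fun n => ?_)
  rcases lt_trichotomy n 0 with hn | rfl | hn
  · rw [abs_of_neg hn]; nlinarith
  · simp
  · rw [abs_of_pos hn]; nlinarith

end SmallNome

/-! ### Lambert series -/

/-- The general term of a Lambert series. -/
noncomputable def lambertTerm (x : ℂ) (b k : ℤ) : ℂ :=
  (-1) ^ k * x ^ (3 * k ^ 2 + (2 * b + 1) * k) * (1 - x ^ (10 * k))⁻¹

/-- The part of a Lambert series indexed by the residue class of `j` modulo `5`. -/
noncomputable def lambertPart (x : ℂ) (b j : ℤ) : ℂ := ∑' m : ℤ, lambertTerm x b (5 * m + j)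

lemma hasSum_mod_five {f : ℤ → ℂ} (hf : Summable f) :
    HasSum (fun m : ℤ => f (5 * m) + f (5 * m + 1) + f (5 * m + 2) + f (5 * m + 3)
      + f (5 * m + 4)) (∑' k, f k) := by
  have h := ((Int.divModEquiv 5).symm.hasSum_iff.mpr hf.hasSum).prod_fiberwise
    fun m => hasSum_fintype _
  simpa [Fin.sum_univ_five, Int.divModEquiv, mul_comm] using h

lemma tsum_mod_five {f : ℤ → ℂ} (hf : Summable f) :
    ∑' k, f k = ∑' m : ℤ, f (5 * m) + ∑' m : ℤ, f (5 * m + 1) + ∑' m : ℤ, f (5 * m + 2)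
      + ∑' m : ℤ, f (5 * m + 3) + ∑' m : ℤ, f (5 * m + 4) := by
  have h (j : ℤ) : HasSum (fun m : ℤ => f (5 * m + j)) (∑' m : ℤ, f (5 * m + j)) :=
    (hf.comp_injective (SmallNome.injective_five_mul_add j)).hasSum
  have h0 := h 0
  simp only [add_zero] at h0
  exact (hasSum_mod_five hf).unique ((((h0.add (h 1)).add (h 2)).add (h 3)).add (h 4))

namespace SmallNome

variable {x : ℂ}

lemma inv_one_sub_zpow_neg (hx : SmallNome x) (n : ℤ) :
    (1 - x ^ (-n))⁻¹ = -(x ^ n * (1 - x ^ n)⁻¹) := by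
  rcases eq_or_ne n 0 with rfl | hn
  · simp
  · have h0 := zpow_ne_zero n hx.ne_zero
    have h1 := sub_ne_zero.mpr (hx.zpow_ne_one hn)
    have h2 := sub_ne_zero.mpr (hx.zpow_ne_one hn).symm
    rw [zpow_neg]
    field_simp
    ring

lemma summable_norm_mul_inv (hx : SmallNome x) {ι : Type*} {f : ι → ℂ} (e : ι → ℤ)
    (hf : Summable fun i => ‖f i‖) : Summable fun i => ‖f i * (1 - x ^ e i)⁻¹‖ := by
  refine Summable.of_nonneg_of_le (fun _ => norm_nonneg _) (fun i => ?_) (hf.mul_right 2)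
  rw [norm_mul]
  gcongr
  exact hx.norm_inv_one_sub_zpow_le _

lemma summable_lambertTerm (hx : SmallNome x) (b : ℤ) :
    Summable fun k => ‖lambertTerm x b k‖ := by
  refine hx.summable_norm_mul_inv _ (hx.summable_norm_sign_zpow (1 + (|b| + 1) ^ 2) fun k => ?_)
  rcases abs_cases k with ⟨h, h'⟩ | ⟨h, h'⟩ <;> rcases abs_cases b with ⟨g, g'⟩ | ⟨g, g'⟩ <;>
    rw [h, g] <;> nlinarith [sq_nonneg (k + b), sq_nonneg (k + b + 1), sq_nonneg (k + b - 1)]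

lemma summable_appell (hx : SmallNome x) (n : ℤ) :
    Summable fun k : ℤ => ‖(-1 : ℂ) ^ k * x ^ (5 * k ^ 2 + 5 * k - 10 * n * k)‖ :=
  hx.summable_norm_sign_zpow (10 + 10 * n ^ 2) fun k => by
    rcases abs_cases k with ⟨h, h'⟩ | ⟨h, h'⟩ <;> rw [h] <;>
      nlinarith [sq_nonneg (2 * k - 2 * n + 1), sq_nonneg (k - 2 * n + 1), sq_nonneg (k - n)]

lemma tsum_appell_eq_zero (x : ℂ) (n : ℤ) :
    ∑' k : ℤ, (-1 : ℂ) ^ k * x ^ (5 * k ^ 2 + 5 * k - 10 * n * k) = 0 := by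
  refine self_eq_neg.mp ?_
  conv_lhs => rw [← (Equiv.subLeft (2 * n - 1)).tsum_eq]
  rw [← tsum_neg]
  refine tsum_congr fun k => ?_
  rw [Equiv.subLeft_apply, show 2 * n - 1 - k = 2 * n + -k - 1 by ring,
    zpow_sub_one₀ (by norm_num), zpow_add₀ (by norm_num), neg_one_zpow_two_mul,
    neg_one_zpow_neg]
  ring_nf

lemma tsum_appell_sub (hx : SmallNome x) (n : ℤ) :
    ∑' k : ℤ, (-1) ^ k * x ^ (5 * k ^ 2 + 5 * k - 10 * n * k) * (1 - x ^ (10 * k))⁻¹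
      - ∑' k : ℤ, (-1) ^ k * x ^ (5 * k ^ 2 + 5 * k - 10 * (n - 1) * k) * (1 - x ^ (10 * k))⁻¹
      = -1 := by
  have hs := (hx.summable_appell n).of_norm
  rw [← ((hx.summable_norm_mul_inv _ (hx.summable_appell n)).of_norm).tsum_sub
    ((hx.summable_norm_mul_inv _ (hx.summable_appell (n - 1))).of_norm)]
  have h := hs.tsum_eq_add_tsum_ite 0
  rw [tsum_appell_eq_zero] at h
  norm_num at h
  rw [← add_right_inj (1 : ℂ), add_neg_cancel, h]
  congr 1
  refine tsum_congr fun k => ?_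
  split_ifs with hk
  · simp [hk]
  · have h2 := sub_ne_zero.mpr (hx.zpow_ne_one (n := 10 * k) (by omega)).symm
    rw [show 5 * k ^ 2 + 5 * k - 10 * (n - 1) * k = 5 * k ^ 2 + 5 * k - 10 * n * k + 10 * k by ring,
      zpow_add₀ hx.ne_zero _ (10 * k)]
    field_simp

lemma tsum_appell (hx : SmallNome x) (n : ℤ) :
    ∑' k : ℤ, (-1 : ℂ) ^ k * x ^ (5 * k ^ 2 + 5 * k - 10 * n * k) * (1 - x ^ (10 * k))⁻¹
      = -(n : ℂ) := by
  induction n using Int.induction_on with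
  | zero =>
    rw [Int.cast_zero, neg_zero]
    refine self_eq_neg.mp ?_
    conv_lhs => rw [← (Equiv.neg ℤ).tsum_eq]
    rw [← tsum_neg]
    refine tsum_congr fun k => ?_
    rw [Equiv.neg_apply, neg_one_zpow_neg, mul_neg 10 k, hx.inv_one_sub_zpow_neg, mul_neg,
      ← mul_assoc, mul_assoc ((-1 : ℂ) ^ k), ← zpow_add₀ hx.ne_zero]
    ring_nf
  | succ i ih =>
    have h := hx.tsum_appell_sub (i + 1)
    rw [add_sub_cancel_right, ih] at h
    push_cast at h ⊢
    linear_combination h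
  | pred i ih =>
    have h := hx.tsum_appell_sub (-i)
    rw [ih] at h
    push_cast at h ⊢
    linear_combination -h

/-- The general term of the triple series expanding a Lambert series twisted by thetas. -/
lemma lambertTerm_mul_theta_terms (hx : SmallNome x) {a b c : ℤ} (h : a + c = b + 3)
    (k n m : ℤ) :
    lambertTerm x b k * (((-1) ^ n * x ^ ((5 * n + (a - k)) * (5 * n + (a - k) - 5))) *
        ((-1) ^ m * x ^ ((5 * m + (c - k)) * (5 * m + (c - k) - 5))))
      = ((-1) ^ n * x ^ ((5 * n + a) * (5 * n + a - 5))) *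
        ((-1) ^ m * x ^ ((5 * m + c) * (5 * m + c - 5))) *
        ((-1) ^ k * x ^ (5 * k ^ 2 + 5 * k - 10 * (n + m) * k) * (1 - x ^ (10 * k))⁻¹) := by
  obtain rfl : b = a + c - 3 := by omega
  have e : x ^ (3 * k ^ 2 + (2 * (a + c - 3) + 1) * k)
        * x ^ ((5 * n + (a - k)) * (5 * n + (a - k) - 5))
        * x ^ ((5 * m + (c - k)) * (5 * m + (c - k) - 5))
      = x ^ ((5 * n + a) * (5 * n + a - 5)) * x ^ ((5 * m + c) * (5 * m + c - 5))
        * x ^ (5 * k ^ 2 + 5 * k - 10 * (n + m) * k) := by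
    simp only [← zpow_add₀ hx.ne_zero]
    congr 1; ring
  rw [lambertTerm]
  linear_combination (-1) ^ k * (-1) ^ n * (-1) ^ m * (1 - x ^ (10 * k))⁻¹ * e

lemma triple_exponent_bound (a b c k n m : ℤ) :
    |k| + (|n| + |m|) ≤ 3 * k ^ 2 + (2 * b + 1) * k
      + (5 * n + (a - k)) * (5 * n + (a - k) - 5) + (5 * m + (c - k)) * (5 * m + (c - k) - 5)
      + ((|b| + 2) ^ 2 + 18 + |a| + |c|) := by
  have key : ∀ u v : ℤ, |u| ≤ (5 * u + (v - k)) * (5 * u + (v - k) - 5) + 9 + |v| + |k| := by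
    intro u v
    have h1 : |u| ≤ |5 * u + (v - k)| + |v| + |k| := by
      rcases abs_cases u with ⟨h, h'⟩ | ⟨h, h'⟩ <;> rw [h]
      · linarith [le_abs_self (5 * u + (v - k)), neg_abs_le v, le_abs_self k]
      · linarith [neg_abs_le (5 * u + (v - k)), le_abs_self v, neg_abs_le k]
    generalize 5 * u + (v - k) = A at *
    have h2 : |A| ≤ A * (A - 5) + 9 := by
      rcases abs_cases A with ⟨h, h'⟩ | ⟨h, h'⟩ <;> rw [h] <;> nlinarith [sq_nonneg (A - 3)]
    linarith
  have h3 : 3 * |k| ≤ 3 * k ^ 2 + (2 * b + 1) * k + (|b| + 2) ^ 2 := by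
    have h4 : -(|2 * b + 1| * |k|) ≤ (2 * b + 1) * k := by
      rw [← abs_mul]; exact neg_abs_le _
    have h5 : |2 * b + 1| ≤ 2 * |b| + 1 := by
      rcases abs_cases b with ⟨h, h'⟩ | ⟨h, h'⟩ <;> rw [h] <;> apply abs_le.mpr <;> omega
    have h6 := mul_le_mul_of_nonneg_right h5 (abs_nonneg k)
    rw [← sq_abs k]
    nlinarith [sq_nonneg (|k| - (|b| + 2)), sq_nonneg |k|]
  linarith [key n a, key m c]

lemma summable_lambertTerm_mul_theta_terms (hx : SmallNome x) (a b c : ℤ) :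
    Summable fun p : ℤ × ℤ × ℤ => lambertTerm x b p.1 *
      (((-1) ^ p.2.1 * x ^ ((5 * p.2.1 + (a - p.1)) * (5 * p.2.1 + (a - p.1) - 5))) *
        ((-1) ^ p.2.2 * x ^ ((5 * p.2.2 + (c - p.1)) * (5 * p.2.2 + (c - p.1) - 5)))) := by
  have h0 := summable_pow_natAbs (norm_nonneg x) hx.norm_lt_one
  have hn : (0 : ℤ → ℝ) ≤ fun n => ‖x‖ ^ n.natAbs := fun n => by positivity
  have h1 := h0.mul_of_nonneg (h0.mul_of_nonneg h0 hn hn) hn fun p => by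
    dsimp only [Pi.zero_apply]; positivity
  refine Summable.of_norm_bounded
    ((h1.mul_left (‖x‖ ^ (-((|b| + 2) ^ 2 + 18 + |a| + |c|)))).mul_right 2) ?_
  rintro ⟨k, n, m⟩
  dsimp only
  have h2 := hx.norm_zpow_le (N := k.natAbs + (n.natAbs + m.natAbs))
    (by push_cast; exact triple_exponent_bound a b c k n m)
  rw [zpow_add₀ hx.ne_zero, zpow_add₀ hx.ne_zero, norm_mul, norm_mul, pow_add, pow_add] at h2
  rw [lambertTerm]
  simp only [norm_mul, norm_neg_one_zpow, one_mul]
  calc _ = ‖x ^ (3 * k ^ 2 + (2 * b + 1) * k)‖ *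
          ‖x ^ ((5 * n + (a - k)) * (5 * n + (a - k) - 5))‖ *
          ‖x ^ ((5 * m + (c - k)) * (5 * m + (c - k) - 5))‖ * ‖(1 - x ^ (10 * k))⁻¹‖ := by ring
    _ ≤ _ := by
      gcongr
      exact hx.norm_inv_one_sub_zpow_le _

lemma tsum_theta_terms (hx : SmallNome x) (a c : ℤ) :
    ∑' p : ℤ × ℤ, (((-1) ^ p.1 * x ^ ((5 * p.1 + a) * (5 * p.1 + a - 5))) *
        ((-1) ^ p.2 * x ^ ((5 * p.2 + c) * (5 * p.2 + c - 5)))) = theta x a * theta x c :=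
  (tsum_mul_tsum_of_summable_norm (hx.summable_theta a) (hx.summable_theta c)).symm

lemma tsum_lambertTerm_mul_theta (hx : SmallNome x) {a b c : ℤ} (h : a + c = b + 3) :
    ∑' k, lambertTerm x b k * (theta x (a - k) * theta x (c - k))
      = -(thetaDeriv x a * theta x c + theta x a * thetaDeriv x c) := by
  have hs := hx.summable_lambertTerm_mul_theta_terms a b c
  have h1 := summable_mul_of_summable_norm (hx.summable_thetaDeriv a) (hx.summable_theta c)
  have h2 := summable_mul_of_summable_norm (hx.summable_theta a) (hx.summable_thetaDeriv c)
  calc ∑' k, lambertTerm x b k * (theta x (a - k) * theta x (c - k))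
      = ∑' (k : ℤ) (p : ℤ × ℤ), lambertTerm x b k *
          (((-1) ^ p.1 * x ^ ((5 * p.1 + (a - k)) * (5 * p.1 + (a - k) - 5))) *
            ((-1) ^ p.2 * x ^ ((5 * p.2 + (c - k)) * (5 * p.2 + (c - k) - 5)))) :=
        tsum_congr fun k => by rw [tsum_mul_left, hx.tsum_theta_terms]
    _ = ∑' (p : ℤ × ℤ) (k : ℤ), lambertTerm x b k *
          (((-1) ^ p.1 * x ^ ((5 * p.1 + (a - k)) * (5 * p.1 + (a - k) - 5))) *
            ((-1) ^ p.2 * x ^ ((5 * p.2 + (c - k)) * (5 * p.2 + (c - k) - 5)))) :=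
        (Summable.tsum_comm (f := fun (k : ℤ) (p : ℤ × ℤ) => lambertTerm x b k *
          (((-1) ^ p.1 * x ^ ((5 * p.1 + (a - k)) * (5 * p.1 + (a - k) - 5))) *
            ((-1) ^ p.2 * x ^ ((5 * p.2 + (c - k)) * (5 * p.2 + (c - k) - 5))))) hs).symm
    _ = ∑' p : ℤ × ℤ, ((-1) ^ p.1 * x ^ ((5 * p.1 + a) * (5 * p.1 + a - 5))) *
          ((-1) ^ p.2 * x ^ ((5 * p.2 + c) * (5 * p.2 + c - 5))) * -((p.1 + p.2 : ℤ) : ℂ) :=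
        tsum_congr fun p => by
          rw [← hx.tsum_appell, ← tsum_mul_left]
          exact tsum_congr fun k => hx.lambertTerm_mul_theta_terms h k p.1 p.2
    _ = -(thetaDeriv x a * theta x c + theta x a * thetaDeriv x c) := by
        rw [thetaDeriv, theta, theta, thetaDeriv,
          tsum_mul_tsum_of_summable_norm (hx.summable_thetaDeriv _) (hx.summable_theta _),
          tsum_mul_tsum_of_summable_norm (hx.summable_theta _) (hx.summable_thetaDeriv _),
          ← h1.tsum_add h2, ← tsum_neg]
        refine tsum_congr fun p => ?_
        push_cast
        ring

lemma summable_lambertTerm_mul_theta (hx : SmallNome x) (a b c : ℤ) :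
    Summable fun k => lambertTerm x b k * (theta x (a - k) * theta x (c - k)) := by
  simp_rw [← hx.tsum_theta_terms, ← tsum_mul_left]
  exact (hx.summable_lambertTerm_mul_theta_terms a b c).prod

lemma tsum_lambertTerm_class (x : ℂ) (a b c j : ℤ) :
    ∑' m : ℤ, lambertTerm x b (5 * m + j) * (theta x (a - (5 * m + j)) * theta x (c - (5 * m + j)))
      = lambertPart x b j * (theta x (a - j) * theta x (c - j)) := by
  rw [lambertPart, ← tsum_mul_right]
  refine tsum_congr fun m => ?_
  rw [show a - (5 * m + j) = a - j - 5 * m by ring, show c - (5 * m + j) = c - j - 5 * m by ring,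
    theta_sub_five_mul, theta_sub_five_mul, mul_mul_mul_comm, neg_one_zpow_mul_self, one_mul]

/-- Linear relations between the dissected Lambert series. -/
lemma sum_lambertPart_mul_theta (hx : SmallNome x) {a b c : ℤ} (h : a + c = b + 3) :
    lambertPart x b 0 * (theta x a * theta x c)
      + lambertPart x b 1 * (theta x (a - 1) * theta x (c - 1))
      + lambertPart x b 2 * (theta x (a - 2) * theta x (c - 2))
      + lambertPart x b 3 * (theta x (a - 3) * theta x (c - 3))
      + lambertPart x b 4 * (theta x (a - 4) * theta x (c - 4))
      = -(thetaDeriv x a * theta x c + theta x a * thetaDeriv x c) := by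
  rw [← hx.tsum_lambertTerm_mul_theta h, tsum_mod_five (hx.summable_lambertTerm_mul_theta a b c)]
  simp only [tsum_lambertTerm_class]
  have h0 := tsum_lambertTerm_class x a b c 0
  simp only [add_zero, sub_zero] at h0
  rw [h0]

end SmallNome

/-! ### The dissection of the rank difference series -/

/-- The exponents divisible by `5` in the rank difference series. -/
noncomputable def rankPartZero (x : ℂ) : ℂ := lambertPart x 4 1 / eulerPart x 4

/-- The exponents congruent to `4` modulo `5` in the rank difference series. -/
noncomputable def rankPartFour (x : ℂ) : ℂ := thetaDeriv x 0 / (theta x 2 * eulerPart x 4)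

/-- The exponents congruent to `1` modulo `5` in the rank difference series. -/
noncomputable def rankPartOne (x : ℂ) : ℂ :=
  (2 * lambertPart x 1 2 - theta x 1 * thetaDeriv x 0 / theta x 2 ^ 2) / eulerPart x 4

lemma mul_zpow_of_pow_five {w x : ℂ} (hw : w ^ 5 = 1) {e v : ℤ} (h : (5 : ℤ) ∣ e - v) :
    (w * x) ^ e = w ^ v * x ^ e := by
  obtain ⟨u, hu⟩ := h
  have hw0 : w ≠ 0 := by rintro rfl; norm_num at hw
  have h5 : w ^ (5 : ℤ) = 1 := by exact_mod_cast hw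
  rw [mul_zpow, show e = 5 * u + v by omega, zpow_add₀ hw0, zpow_mul, h5, one_zpow, one_mul]

lemma theta_rotate {w : ℂ} (hw : w ^ 5 = 1) (x : ℂ) (a : ℤ) :
    theta (w * x) a = w ^ (a ^ 2) * theta x a := by
  rw [theta, theta, ← tsum_mul_left]
  refine tsum_congr fun n => ?_
  rw [mul_zpow_of_pow_five hw (v := a ^ 2) ⟨5 * n ^ 2 + 2 * a * n - 5 * n - a, by ring⟩]
  ring

lemma thetaDeriv_zero_rotate {w : ℂ} (hw : w ^ 5 = 1) (x : ℂ) :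
    thetaDeriv (w * x) 0 = thetaDeriv x 0 := by
  rw [thetaDeriv, thetaDeriv]
  refine tsum_congr fun n => ?_
  rw [mul_zpow_of_pow_five hw (v := 0) ⟨5 * n ^ 2 - 5 * n, by ring⟩, zpow_zero, one_mul]

lemma eulerPart_rotate {w : ℂ} (hw : w ^ 5 = 1) (x : ℂ) (j : ℤ) :
    eulerPart (w * x) j = w ^ (3 * j ^ 2 + j) * eulerPart x j := by
  rw [eulerPart, eulerPart, ← tsum_mul_left]
  refine tsum_congr fun m => ?_
  rw [mul_zpow_of_pow_five hw (v := 3 * j ^ 2 + j) ⟨15 * m ^ 2 + 6 * m * j + m, by ring⟩]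
  ring

lemma lambertPart_rotate {w : ℂ} (hw : w ^ 5 = 1) (x : ℂ) (b j : ℤ) :
    lambertPart (w * x) b j = w ^ (3 * j ^ 2 + (2 * b + 1) * j) * lambertPart x b j := by
  rw [lambertPart, lambertPart, ← tsum_mul_left]
  refine tsum_congr fun m => ?_
  rw [lambertTerm, lambertTerm,
    mul_zpow_of_pow_five hw (v := 3 * j ^ 2 + (2 * b + 1) * j)
      ⟨15 * m ^ 2 + 6 * m * j + (2 * b + 1) * m, by ring⟩,
    mul_zpow_of_pow_five hw (v := 0) ⟨2 * (5 * m + j), by ring⟩, zpow_zero, one_mul]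
  ring

lemma zpow_eq_of_pow_five {w : ℂ} (hw : w ^ 5 = 1) {e v : ℤ} (h : (5 : ℤ) ∣ e - v) :
    w ^ e = w ^ v := by
  simpa using mul_zpow_of_pow_five (x := 1) hw h

lemma rankPartZero_rotate {w : ℂ} (hw : w ^ 5 = 1) (x : ℂ) :
    rankPartZero (w * x) = rankPartZero x := by
  have hw0 : w ≠ 0 := by rintro rfl; norm_num at hw
  rw [rankPartZero, rankPartZero, lambertPart_rotate hw, eulerPart_rotate hw,
    zpow_eq_of_pow_five hw (e := 3 * 1 ^ 2 + (2 * 4 + 1) * 1) (v := 2) (by norm_num),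
    zpow_eq_of_pow_five hw (e := 3 * 4 ^ 2 + 4) (v := 2) (by norm_num),
    mul_div_mul_left _ _ (zpow_ne_zero _ hw0)]

lemma rankPartFour_rotate {w : ℂ} (hw : w ^ 5 = 1) (x : ℂ) :
    rankPartFour (w * x) = w ^ 4 * rankPartFour x := by
  have hw0 : w ≠ 0 := by rintro rfl; norm_num at hw
  rw [rankPartFour, rankPartFour, thetaDeriv_zero_rotate hw, theta_rotate hw, eulerPart_rotate hw,
    zpow_eq_of_pow_five hw (e := 3 * 4 ^ 2 + 4) (v := 2) (by norm_num), mul_mul_mul_comm,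
    ← zpow_add₀ hw0, zpow_eq_of_pow_five hw (e := 2 ^ 2 + 2) (v := 1) (by norm_num), zpow_one,
    div_mul_eq_div_div, ← mul_div_assoc, div_eq_mul_inv (thetaDeriv x 0) w,
    ← eq_inv_of_mul_eq_one_left (a := w ^ 4) (b := w) (by rw [← pow_succ, hw]), mul_comm (w ^ 4)]

lemma rankPartOne_rotate {w : ℂ} (hw : w ^ 5 = 1) (x : ℂ) :
    rankPartOne (w * x) = w * rankPartOne x := by
  have hw0 : w ≠ 0 := by rintro rfl; norm_num at hw
  have h8 : (w ^ (4 : ℤ)) ^ 2 = w ^ (3 : ℤ) := by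
    rw [← zpow_natCast, ← zpow_mul]
    exact zpow_eq_of_pow_five hw (by norm_num)
  have h : w ^ (1 : ℤ) * theta x 1 * thetaDeriv x 0 / (w ^ (4 : ℤ) * theta x 2) ^ 2
      = w ^ (3 : ℤ) * (theta x 1 * thetaDeriv x 0 / theta x 2 ^ 2) := by
    rw [mul_pow, h8, zpow_eq_of_pow_five hw (e := 1) (v := 3 + 3) (by norm_num), zpow_add₀ hw0,
      mul_assoc, mul_assoc, mul_div_mul_left _ _ (zpow_ne_zero _ hw0), mul_div_assoc]
  rw [rankPartOne, rankPartOne, lambertPart_rotate hw, theta_rotate hw, theta_rotate hw,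
    thetaDeriv_zero_rotate hw, eulerPart_rotate hw,
    zpow_eq_of_pow_five hw (e := 3 * 2 ^ 2 + (2 * 1 + 1) * 2) (v := 3) (by norm_num),
    zpow_eq_of_pow_five hw (e := 3 * 4 ^ 2 + 4) (v := 2) (by norm_num),
    zpow_eq_of_pow_five hw (e := 1 ^ 2) (v := 1) (by norm_num),
    zpow_eq_of_pow_five hw (e := 2 ^ 2) (v := 4) (by norm_num), h, mul_left_comm, ← mul_sub,
    show (3 : ℤ) = 2 + 1 by norm_num, zpow_add₀ hw0, mul_assoc,
    mul_div_mul_left _ _ (zpow_ne_zero _ hw0), zpow_one, mul_div_assoc]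

namespace SmallNome

variable {x : ℂ}

lemma tsum_pentagonal (hx : SmallNome x) :
    ∑' k : ℤ, (-1 : ℂ) ^ k * x ^ (3 * k ^ 2 + k) = eulerPart x 0 + eulerPart x 1 + eulerPart x 2
      + eulerPart x 3 + eulerPart x 4 := by
  rw [tsum_mod_five hx.summable_pentagonal.of_norm]
  simp only [eulerPart, add_zero]

lemma tsum_lambertTerm (hx : SmallNome x) (b : ℤ) :
    ∑' k, lambertTerm x b k = lambertPart x b 0 + lambertPart x b 1 + lambertPart x b 2
      + lambertPart x b 3 + lambertPart x b 4 := by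
  rw [tsum_mod_five (hx.summable_lambertTerm b).of_norm]
  simp only [lambertPart, add_zero]

/-- The product of Euler's series and the sum of the three dissected parts. -/
lemma tsum_pentagonal_mul_rankParts (hx : SmallNome x) :
    (∑' k : ℤ, (-1 : ℂ) ^ k * x ^ (3 * k ^ 2 + k))
        * (rankPartZero x + rankPartFour x + rankPartOne x)
      = 2 * ∑' k, lambertTerm x 1 k + ∑' k, lambertTerm x 4 k := by
  have a1 := hx.sum_lambertPart_mul_theta (a := 2) (b := 1) (c := 2) (by norm_num)
  have a2 := hx.sum_lambertPart_mul_theta (a := 1) (b := 1) (c := 3) (by norm_num)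
  have a3 := hx.sum_lambertPart_mul_theta (a := 6) (b := 4) (c := 1) (by norm_num)
  have a4 := hx.sum_lambertPart_mul_theta (a := 5) (b := 4) (c := 2) (by norm_num)
  have t0 := theta_zero x
  have t1 := theta_neg x 1
  have t2 := theta_neg x 2
  have t3 : theta x (-3) = -theta x 2 := by rw [theta_neg, theta_three]
  have t5 := theta_add_five x 0
  have t6 := theta_add_five x 1
  have d3 := thetaDeriv_five_sub x 2
  have d5 := hx.thetaDeriv_add_five 0
  have d6 := hx.thetaDeriv_add_five 1
  norm_num at a1 a2 a3 a4 t5 t6 d3 d5 d6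
  rw [t0] at a1 a2 a3 a4 d5 t5
  rw [theta_three] at a2 a3 a4
  rw [t1] at a1 a2 a3 a4
  rw [t2] at a1 a3 a4
  rw [theta_four] at a3 a4
  rw [t3] at a2 a3
  rw [t6, d6] at a3
  rw [t5, d5] at a4
  rw [d3] at a2
  have w1 := hx.thetaDeriv_zero_mul_theta_two_pow
  have w2 := hx.thetaDeriv_zero_mul_theta_one_pow
  have q1 := hx.eulerPart_zero_add_three_mul_theta_one
  have q2 := hx.eulerPart_one_add_two_mul_theta_two
  have hp := hx.theta_ne_zero (a := 1) (by norm_num) (by norm_num)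
  have hr := hx.theta_ne_zero (a := 2) (by norm_num) (by norm_num)
  have he := hx.eulerPart_four_ne_zero
  rw [hx.tsum_pentagonal, hx.tsum_lambertTerm, hx.tsum_lambertTerm, rankPartZero, rankPartFour,
    rankPartOne]
  generalize theta x 1 = p at *
  generalize theta x 2 = r at *
  generalize thetaDeriv x 1 = p' at *
  generalize thetaDeriv x 2 = r' at *
  generalize thetaDeriv x 0 = j at *
  generalize eulerPart x 4 = e at *
  have e0 : eulerPart x 0 + eulerPart x 3 = -(e * r / p) := by
    field_simp; linear_combination q1
  have e2 : eulerPart x 1 + eulerPart x 2 = e * p / r := by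
    field_simp; linear_combination q2
  have f4 : lambertPart x 1 2 =
      ((lambertPart x 1 0 + lambertPart x 1 4) * p * r + p' * r - p * r') / p ^ 2 := by
    field_simp; linear_combination -a2
  have f3 : lambertPart x 1 1 + lambertPart x 1 3 =
      (-2 * r * r' - r ^ 2 * (lambertPart x 1 0 + lambertPart x 1 4)) / p ^ 2 := by
    field_simp; linear_combination a1
  have f1 : lambertPart x 4 1 =
      (j * r + p * r * (lambertPart x 4 3 + lambertPart x 4 4)) / p ^ 2 := by
    field_simp; linear_combination a4
  have f0 : lambertPart x 4 0 + lambertPart x 4 2 =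
      (p ^ 2 - 2 * p * p' - r ^ 2 * (lambertPart x 4 3 + lambertPart x 4 4)) / p ^ 2 := by
    field_simp; linear_combination -a3
  have h1 : (eulerPart x 0 + eulerPart x 3) * (lambertPart x 4 1 / e)
      + (eulerPart x 1 + eulerPart x 2) * ((2 * lambertPart x 1 2 - p * j / r ^ 2) / e)
      = 2 * (lambertPart x 1 0 + lambertPart x 1 4) + (lambertPart x 4 0 + lambertPart x 4 2) := by
    rw [e0, e2, f1, f4, f0]
    field_simp
    linear_combination -r ^ 2 * w1 - p ^ 2 * w2
  have h2 : (eulerPart x 0 + eulerPart x 3) * (j / (r * e))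
      + (eulerPart x 1 + eulerPart x 2) * (lambertPart x 4 1 / e)
      = lambertPart x 4 3 + lambertPart x 4 4 := by
    rw [e0, e2, f1]
    field_simp
    ring
  have h3 : (eulerPart x 0 + eulerPart x 3) * ((2 * lambertPart x 1 2 - p * j / r ^ 2) / e)
      + e * (j / (r * e)) = 2 * (lambertPart x 1 1 + lambertPart x 1 3) := by
    rw [e0, f4, f3]
    field_simp
    linear_combination 2 * w2
  have h4 : e * (lambertPart x 4 1 / e) = lambertPart x 4 1 := by field_simp
  have h5 : e * ((2 * lambertPart x 1 2 - p * j / r ^ 2) / e)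
      + (eulerPart x 1 + eulerPart x 2) * (j / (r * e)) = 2 * lambertPart x 1 2 := by
    rw [e2]
    field_simp
    ring
  linear_combination h1 + h2 + h3 + h4 + h5

end SmallNome

/-! ### Dyson's adjoint bijection -/

lemma multiset_sup_mem {s : Multiset ℕ} (hs : s ≠ 0) : s.sup ∈ s := by
  induction s using Multiset.induction_on with
  | empty => exact absurd rfl hs
  | cons a s ih =>
    rw [Multiset.sup_cons]
    rcases eq_or_ne s 0 with rfl | h
    · simp
    · rcases le_total a s.sup with h1 | h1
      · rw [sup_eq_right.mpr h1]; exact Multiset.mem_cons_of_mem (ih h)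
      · rw [sup_eq_left.mpr h1]; exact Multiset.mem_cons_self _ _

lemma multiset_sum_map_pred {s : Multiset ℕ} (hs : ∀ i ∈ s, 0 < i) :
    (s.map Nat.pred).sum + s.card = s.sum := by
  induction s using Multiset.induction_on with
  | empty => simp
  | cons a s ih =>
    have h1 := ih fun i hi => hs i (Multiset.mem_cons_of_mem hi)
    have h2 := hs a (Multiset.mem_cons_self _ _)
    simp only [Multiset.map_cons, Multiset.sum_cons, Multiset.card_cons, Nat.pred_eq_sub_one]
      at h1 ⊢
    omega

lemma multiset_sum_filter_ne_zero (s : Multiset ℕ) : (s.filter (· ≠ 0)).sum = s.sum := by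
  induction s using Multiset.induction_on with
  | empty => simp
  | cons a s ih =>
    rcases eq_or_ne a 0 with rfl | h
    · simpa using ih
    · rw [Multiset.filter_cons_of_pos (p := (· ≠ 0)) _ h, Multiset.sum_cons, Multiset.sum_cons, ih]

/-- Remove the first column of a partition and add a new part, `m + 1` units larger than the
number of parts. -/
def columnToRow (m : ℤ) (s : Multiset ℕ) : Multiset ℕ :=
  ((s.card + m + 1).toNat ::ₘ s.map Nat.pred).filter (· ≠ 0)

/-- Remove the largest part of a partition and add a new first column, `m + 1` units shorter. -/
def rowToColumn (m : ℤ) (s : Multiset ℕ) : Multiset ℕ :=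
  (s.erase s.sup).map Nat.succ
    + Multiset.replicate (s.sup - m - 1 - (s.erase s.sup).card : ℤ).toNat 1

section

variable {m : ℤ} {s : Multiset ℕ}

lemma columnToRow_pos {i : ℕ} (hi : i ∈ columnToRow m s) : 0 < i :=
  Nat.pos_of_ne_zero (Multiset.mem_filter.mp hi).2

lemma sum_columnToRow (hs : ∀ i ∈ s, 0 < i) (h : 0 ≤ s.card + m + 1) :
    ((columnToRow m s).sum : ℤ) = s.sum + m + 1 := by
  have h1 := multiset_sum_map_pred hs
  rw [columnToRow, multiset_sum_filter_ne_zero, Multiset.sum_cons]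
  omega

lemma le_sup_of_mem_map_pred {N i : ℕ} (hN : s.sup ≤ N + 1) (hi : i ∈ s.map Nat.pred) : i ≤ N := by
  obtain ⟨j, hj, rfl⟩ := Multiset.mem_map.mp hi
  have := Multiset.le_sup hj
  rw [Nat.pred_eq_sub_one]
  omega

lemma sup_columnToRow (hr : (s.sup : ℤ) - s.card ≤ m + 2) (h : 0 ≤ s.card + m + 1) :
    ((columnToRow m s).sup : ℤ) = s.card + m + 1 := by
  have h1 : (columnToRow m s).sup = (s.card + m + 1).toNat := by
    apply le_antisymm
    · refine Multiset.sup_le.mpr fun i hi => ?_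
      rcases Multiset.mem_cons.mp (Multiset.mem_filter.mp hi).1 with rfl | hi
      · exact le_rfl
      · exact le_sup_of_mem_map_pred (by omega) hi
    · rcases Nat.eq_zero_or_pos (s.card + m + 1).toNat with h0 | h0
      · rw [h0]; exact Nat.zero_le _
      · exact Multiset.le_sup (Multiset.mem_filter.mpr ⟨Multiset.mem_cons_self _ _, h0.ne'⟩)
  omega

lemma card_columnToRow_le : (columnToRow m s).card ≤ s.card + 1 :=
  (Multiset.card_le_card (Multiset.filter_le _ _)).trans (by simp)

lemma map_succ_filter_map_pred (hs : ∀ i ∈ s, 0 < i) :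
    ((s.map Nat.pred).filter (· ≠ 0)).map Nat.succ = s.filter (· ≠ 1) := by
  induction s using Multiset.induction_on with
  | empty => simp
  | cons a s ih =>
    have h1 := ih fun i hi => hs i (Multiset.mem_cons_of_mem hi)
    have h2 := hs a (Multiset.mem_cons_self _ _)
    obtain ⟨b, rfl⟩ := Nat.exists_eq_succ_of_ne_zero h2.ne'
    rw [Multiset.map_cons, Nat.pred_succ]
    rcases eq_or_ne b 0 with rfl | hb
    · simpa using h1
    · rw [Multiset.filter_cons_of_pos (p := (· ≠ 0)) _ hb,
        Multiset.filter_cons_of_pos (p := (· ≠ 1)) _ (by simpa using hb),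
        Multiset.map_cons, h1]

lemma rowToColumn_columnToRow (hs : ∀ i ∈ s, 0 < i) (hr : (s.sup : ℤ) - s.card ≤ m + 2)
    (h : 0 ≤ s.card + m + 1) : rowToColumn m (columnToRow m s) = s := by
  have h1 := sup_columnToRow hr h
  have h2 : (columnToRow m s).erase (columnToRow m s).sup = (s.map Nat.pred).filter (· ≠ 0) := by
    have h3 : (columnToRow m s).sup = (s.card + m + 1).toNat := by omega
    rw [h3, columnToRow]
    rcases Nat.eq_zero_or_pos (s.card + m + 1).toNat with h0 | h0
    · rw [Multiset.filter_cons_of_neg _ (by simpa using h0), Multiset.erase_of_notMem]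
      rw [h0]; simp
    · rw [Multiset.filter_cons_of_pos (p := (· ≠ 0)) _ h0.ne', Multiset.erase_cons_head]
  have h4 := map_succ_filter_map_pred hs
  have h5 := congrArg Multiset.card h4
  have h6 := congrArg Multiset.card (Multiset.filter_add_not (· = 1) s)
  rw [Multiset.card_map] at h5
  rw [Multiset.card_add] at h6
  change _ + (s.filter (· ≠ 1)).card = _ at h6
  rw [rowToColumn, h2, h4, h5, h1]
  conv_rhs => rw [← Multiset.filter_add_not (· = 1) s, add_comm]
  congr 1
  have h7 : (s.filter (· = 1)).card = s.count 1 := by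
    rw [Multiset.filter_eq', Multiset.card_replicate]
  rw [Multiset.filter_eq']
  congr 1
  omega

lemma rowToColumn_pos {i : ℕ} (hi : i ∈ rowToColumn m s) : 0 < i := by
  rcases Multiset.mem_add.mp hi with h | h
  · obtain ⟨j, -, rfl⟩ := Multiset.mem_map.mp h; exact Nat.succ_pos j
  · rw [Multiset.eq_of_mem_replicate h]; exact Nat.one_pos

lemma card_erase_sup (s : Multiset ℕ) : (s.erase s.sup).card = s.card - 1 := by
  rcases eq_or_ne s 0 with rfl | hs
  · simp
  · exact Multiset.card_erase_of_mem (multiset_sup_mem hs)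

lemma card_rowToColumn (h : ((s.erase s.sup).card : ℤ) + m + 1 ≤ s.sup) :
    ((rowToColumn m s).card : ℤ) = s.sup - m - 1 := by
  rw [rowToColumn, Multiset.card_add, Multiset.card_map, Multiset.card_replicate]
  push_cast
  omega

lemma sum_rowToColumn (h : ((s.erase s.sup).card : ℤ) + m + 1 ≤ s.sup) :
    ((rowToColumn m s).sum : ℤ) = s.sum - m - 1 := by
  have h1 : (s.erase s.sup).sum + s.sup = s.sum := by
    rcases eq_or_ne s 0 with rfl | hs
    · simp
    · conv_rhs => rw [← Multiset.cons_erase (multiset_sup_mem hs), Multiset.sum_cons, add_comm]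
  have h2 : ((s.erase s.sup).map Nat.succ).sum = (s.erase s.sup).sum + (s.erase s.sup).card := by
    simp [Nat.succ_eq_add_one, Multiset.sum_map_add]
  rw [rowToColumn, Multiset.sum_add, h2, Multiset.sum_replicate, smul_eq_mul, mul_one]
  omega

lemma sup_rowToColumn_le : (rowToColumn m s).sup ≤ s.sup + 1 := by
  refine Multiset.sup_le.mpr fun i hi => ?_
  rcases Multiset.mem_add.mp hi with h | h
  · obtain ⟨j, hj, rfl⟩ := Multiset.mem_map.mp h
    exact Nat.succ_le_succ (Multiset.le_sup (Multiset.mem_of_mem_erase hj))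
  · rw [Multiset.eq_of_mem_replicate h]; omega

lemma columnToRow_rowToColumn (hs : ∀ i ∈ s, 0 < i)
    (h : ((s.erase s.sup).card : ℤ) + m + 1 ≤ s.sup) :
    columnToRow m (rowToColumn m s) = s := by
  rw [columnToRow, card_rowToColumn h, show (s.sup - m - 1 + m + 1 : ℤ).toNat = s.sup by omega,
    rowToColumn, Multiset.map_add, Multiset.map_map, Multiset.map_replicate]
  simp only [Function.comp_def, Nat.succ_eq_add_one, Nat.pred_eq_sub_one, add_tsub_cancel_right,
    Multiset.map_id', tsub_self]
  rcases eq_or_ne s 0 with rfl | h0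
  · simp [Multiset.mem_replicate]
  · rw [← Multiset.cons_add, Multiset.cons_erase (multiset_sup_mem h0), Multiset.filter_add,
      Multiset.filter_eq_self.mpr fun i hi => (hs i hi).ne', add_eq_left]
    exact Multiset.filter_eq_nil.mpr fun i hi => by simp [Multiset.eq_of_mem_replicate hi]

end

/-- The number of partitions of `n` with rank at least `m`. -/
noncomputable def rankGeCount (m : ℤ) (n : ℕ) : ℕ :=
  Fintype.card {P : n.Partition // m ≤ partitionRank P}

/-- The number of partitions of `n` with rank at most `m`. -/
noncomputable def rankLeCount (m : ℤ) (n : ℕ) : ℕ :=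
  Fintype.card {P : n.Partition // partitionRank P ≤ m}

lemma card_erase_sup_add_le {n : ℕ} {m : ℤ} {P : n.Partition} (hP : m ≤ partitionRank P)
    (hm : 0 < (n : ℤ) ∨ m + 1 ≤ 0) :
    ((P.parts.erase P.parts.sup).card : ℤ) + m + 1 ≤ P.parts.sup := by
  rw [partitionRank] at hP
  rw [card_erase_sup]
  rcases eq_or_ne P.parts 0 with h | h
  · have h1 := P.parts_sum
    rw [h] at h1 ⊢
    simp at h1 ⊢
    omega
  · have := Multiset.card_pos.mpr h
    omega

/-- Dyson's adjoint bijection. -/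
lemma rankGeCount_eq_rankLeCount {m : ℤ} {n k : ℕ} (h : (n : ℤ) = k + m + 1) :
    rankGeCount m n = rankLeCount (m + 2) k := by
  have hm : 0 < (n : ℤ) ∨ m + 1 ≤ 0 := by omega
  have hcol : ∀ Q : k.Partition, partitionRank Q ≤ m + 2 → 0 ≤ (Q.parts.card : ℤ) + m + 1 := by
    intro Q hQ
    rw [partitionRank] at hQ
    by_contra hneg
    have h0 : Q.parts.sup = 0 := by omega
    have h1 : Q.parts = 0 := Multiset.eq_zero_of_forall_notMem fun i hi => by
      have := Q.parts_pos hi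
      have := Multiset.le_sup hi
      omega
    have h2 := Q.parts_sum
    rw [h1] at h2 hneg
    simp at h2 hneg
    omega
  refine Fintype.card_congr
    { toFun := fun P => ⟨⟨rowToColumn m P.1.parts, rowToColumn_pos, ?_⟩, ?_⟩
      invFun := fun Q => ⟨⟨columnToRow m Q.1.parts, columnToRow_pos, ?_⟩, ?_⟩
      left_inv := fun P => ?_
      right_inv := fun Q => ?_ }
  · have h1 := sum_rowToColumn (card_erase_sup_add_le P.2 hm)
    rw [P.1.parts_sum] at h1
    omega
  · have h1 := card_rowToColumn (card_erase_sup_add_le P.2 hm)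
    have h2 := sup_rowToColumn_le (m := m) (s := P.1.parts)
    dsimp only [partitionRank]
    omega
  · have h1 := sum_columnToRow (fun i => Q.1.parts_pos) (hcol Q.1 Q.2)
    rw [Q.1.parts_sum] at h1
    omega
  · have h1 := sup_columnToRow Q.2 (hcol Q.1 Q.2)
    have h2 := card_columnToRow_le (m := m) (s := Q.1.parts)
    dsimp only [partitionRank]
    omega
  · exact Subtype.ext (Nat.Partition.ext
      (columnToRow_rowToColumn (fun i => P.1.parts_pos) (card_erase_sup_add_le P.2 hm)))
  · exact Subtype.ext (Nat.Partition.ext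
      (rowToColumn_columnToRow (fun i => Q.1.parts_pos) Q.2 (hcol Q.1 Q.2)))

/-! ### Counting partitions by rank -/

section

variable {n : ℕ}

lemma partition_sup_le (P : n.Partition) : P.parts.sup ≤ n :=
  Multiset.sup_le.mpr fun i hi => by
    rw [← P.parts_sum]; exact Multiset.single_le_sum (fun _ _ => Nat.zero_le _) i hi

lemma partition_card_le (P : n.Partition) : P.parts.card ≤ n := by
  have h := multiset_sum_map_pred fun i hi => P.parts_pos (i := i) hi
  rw [P.parts_sum] at h
  omega

lemma abs_partitionRank_lt (hn : 0 < n) (P : n.Partition) : |partitionRank P| < n := by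
  have h1 := partition_sup_le P
  have h2 := partition_card_le P
  have h3 : P.parts ≠ 0 := fun h => by
    have := P.parts_sum
    rw [h] at this
    simp at this
    omega
  have h4 := Multiset.card_pos.mpr h3
  have h5 := P.parts_pos (multiset_sup_mem h3)
  rw [partitionRank, abs_lt]
  omega

lemma partitionRank_of_zero (P : Nat.Partition 0) : partitionRank P = 0 := by
  have h1 := partition_sup_le P
  have h2 := partition_card_le P
  rw [partitionRank]
  omega

lemma rankGeCount_add_rankLeCount (m : ℤ) (n : ℕ) :
    rankGeCount (m + 1) n + rankLeCount m n = partitionFn n := by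
  have h := Fintype.card_subtype_compl fun P : n.Partition => partitionRank P ≤ m
  have h1 := Fintype.card_subtype_le fun P : n.Partition => partitionRank P ≤ m
  have h2 : rankGeCount (m + 1) n = Fintype.card {P : n.Partition // ¬partitionRank P ≤ m} :=
    Fintype.card_congr (Equiv.subtypeEquivRight fun P => by omega)
  rw [h2, h, rankLeCount, partitionFn]
  omega

lemma rankGeCount_le (m : ℤ) (n : ℕ) : rankGeCount m n ≤ partitionFn n :=
  Fintype.card_subtype_le _

lemma rankGeCount_eq_zero {m : ℤ} (hm : 0 < m) (h : (n : ℤ) ≤ m) : rankGeCount m n = 0 := by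
  refine Fintype.card_eq_zero_iff.mpr ⟨fun P => ?_⟩
  rcases Nat.eq_zero_or_pos n with rfl | hn
  · have := P.2; rw [partitionRank_of_zero] at this; omega
  · have := P.2; have := (abs_lt.mp (abs_partitionRank_lt hn P.1)).2; omega

lemma rankLeCount_neg_eq_zero {m : ℤ} (hm : 0 < m) (h : (n : ℤ) ≤ m) :
    rankLeCount (-m) n = 0 := by
  refine Fintype.card_eq_zero_iff.mpr ⟨fun P => ?_⟩
  rcases Nat.eq_zero_or_pos n with rfl | hn
  · have := P.2; rw [partitionRank_of_zero] at this; omega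
  · have := P.2; have := (abs_lt.mp (abs_partitionRank_lt hn P.1)).1; omega

lemma rankGeCount_recurrence {m : ℤ} {k : ℕ} (h : (n : ℤ) = k + m + 1) :
    rankGeCount m n + rankGeCount (m + 3) k = partitionFn k := by
  rw [rankGeCount_eq_rankLeCount h, ← rankGeCount_add_rankLeCount (m + 2) k, add_comm,
    show m + 2 + 1 = m + 3 by ring]

lemma rankLeCount_recurrence {m : ℤ} {k : ℕ} (h : (n : ℤ) = k + m + 1) :
    rankLeCount (-m) n + rankLeCount (-(m + 3)) k = partitionFn k := by
  rw [← rankGeCount_add_rankLeCount (-(m + 3)) k,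
    rankGeCount_eq_rankLeCount (m := -(m + 3) + 1) (n := k) (k := n) (by omega)]
  ring_nf

lemma rankLeCount_neg_eq_rankGeCount {m : ℤ} (hm : 0 < m) (n : ℕ) :
    rankLeCount (-m) n = rankGeCount m n := by
  induction n using Nat.strong_induction_on generalizing m with
  | _ n ih =>
    rcases le_or_gt (n : ℤ) m with h | h
    · rw [rankLeCount_neg_eq_zero hm h, rankGeCount_eq_zero hm h]
    · have hk : (n : ℤ) = ((n : ℤ) - m - 1).toNat + m + 1 := by omega
      have h1 := rankGeCount_recurrence hk
      have h2 := rankLeCount_recurrence hk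
      have h3 := @ih ((n : ℤ) - m - 1).toNat (by omega) (m + 3) (by omega)
      omega

lemma partitionFn_succ (k : ℕ) :
    partitionFn (k + 1) = rankGeCount 1 (k + 1) + rankGeCount 0 (k + 1) := by
  have h1 := rankGeCount_add_rankLeCount 0 (k + 1)
  have h2 := rankLeCount_recurrence (m := 0) (n := k + 1) (k := k) (by push_cast; ring)
  have h3 := rankLeCount_neg_eq_rankGeCount (m := 3) (by norm_num) k
  have h4 := rankGeCount_recurrence (m := 0) (n := k + 1) (k := k) (by push_cast; ring)
  norm_num at h1 h2 h3 h4
  omega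

lemma partitionFn_zero : partitionFn 0 = 1 := by
  rw [partitionFn, Fintype.card_eq_one_iff]
  exact ⟨default, fun P => Subsingleton.elim _ _⟩

lemma partitionFn_le (n : ℕ) : partitionFn n ≤ 2 ^ n := by
  have h := Fintype.card_le_of_surjective _ (Nat.Partition.ofComposition_surj (n := n))
  rw [composition_card] at h
  exact h.trans (Nat.pow_le_pow_right (by norm_num) (Nat.sub_le _ _))

end

/-- The difference between the indicator functions of the residues `1` and `2` modulo `5`. -/
def residueSign (r : ℤ) : ℤ := (if r % 5 = 1 then 1 else 0) - if r % 5 = 2 then 1 else 0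

lemma sum_range_indicator (r : ℤ) (J : ℕ) :
    ∑ j ∈ Finset.range J,
      ((if 5 * (j : ℤ) + 1 ≤ r then 1 else 0) - 2 * (if 5 * (j : ℤ) + 2 ≤ r then 1 else 0)
        + (if 5 * (j : ℤ) + 3 ≤ r then 1 else 0)
        + 2 * (if r ≤ -(5 * (j : ℤ) + 4) then 1 else 0) - (if r ≤ -(5 * (j : ℤ) + 5) then 1 else 0)
        - (if r ≤ -(5 * (j : ℤ) + 3) then 1 else 0))
      = if |r| ≤ 5 * J then residueSign r else 0 := by
  have hj (j : ℕ) :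
      ((if 5 * (j : ℤ) + 1 ≤ r then 1 else 0) - 2 * (if 5 * (j : ℤ) + 2 ≤ r then 1 else 0)
        + (if 5 * (j : ℤ) + 3 ≤ r then 1 else 0)
        + 2 * (if r ≤ -(5 * (j : ℤ) + 4) then 1 else 0) - (if r ≤ -(5 * (j : ℤ) + 5) then 1 else 0)
        - (if r ≤ -(5 * (j : ℤ) + 3) then 1 else 0) : ℤ)
      = (if r = 5 * j + 1 ∨ r = -(5 * j + 4) then 1 else 0)
        - if r = 5 * j + 2 ∨ r = -(5 * j + 3) then 1 else 0 := by
    grind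
  simp only [hj]
  induction J with
  | zero =>
    rcases eq_or_ne r 0 with rfl | h
    · simp [residueSign]
    · simp [h]
  | succ J ih =>
    rw [Finset.sum_range_succ, ih]
    simp only [residueSign, abs_le]
    push_cast
    split_ifs <;> omega

lemma rankGeCount_eq_sum (m : ℤ) (n : ℕ) :
    (rankGeCount m n : ℤ) = ∑ P : n.Partition, if m ≤ partitionRank P then 1 else 0 := by
  rw [rankGeCount, Fintype.card_subtype, Finset.card_filter]
  push_cast
  rfl

lemma rankLeCount_eq_sum (m : ℤ) (n : ℕ) :
    (rankLeCount m n : ℤ) = ∑ P : n.Partition, if partitionRank P ≤ m then 1 else 0 := by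
  rw [rankLeCount, Fintype.card_subtype, Finset.card_filter]
  push_cast
  rfl

lemma rankCount_eq_sum (a b : ℤ) (n : ℕ) :
    (rankCount a b n : ℤ) = ∑ P : n.Partition, if partitionRank P % b = a % b then 1 else 0 := by
  rw [rankCount, Fintype.card_subtype, Finset.card_filter]
  push_cast
  rfl

/-- The contribution of a block of five consecutive ranks to the rank difference. -/
noncomputable def rankBlock (j n : ℕ) : ℤ :=
  rankGeCount (5 * j + 1) n - 2 * rankGeCount (5 * j + 2) n + 2 * rankGeCount (5 * j + 4) n
    - rankGeCount (5 * j + 5) n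

lemma rankCount_sub_rankCount {n J : ℕ} (h : n ≤ J) :
    (rankCount 1 5 n : ℤ) - rankCount 2 5 n = ∑ j ∈ Finset.range J, rankBlock j n := by
  have h1 (j : ℕ) : rankBlock j n = ∑ P : n.Partition,
      ((if 5 * (j : ℤ) + 1 ≤ partitionRank P then 1 else 0)
        - 2 * (if 5 * (j : ℤ) + 2 ≤ partitionRank P then 1 else 0)
        + (if 5 * (j : ℤ) + 3 ≤ partitionRank P then 1 else 0)
        + 2 * (if partitionRank P ≤ -(5 * (j : ℤ) + 4) then 1 else 0)
        - (if partitionRank P ≤ -(5 * (j : ℤ) + 5) then 1 else 0)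
        - (if partitionRank P ≤ -(5 * (j : ℤ) + 3) then 1 else 0)) := by
    simp only [Finset.sum_sub_distrib, Finset.sum_add_distrib, ← Finset.mul_sum,
      ← rankGeCount_eq_sum, ← rankLeCount_eq_sum]
    rw [rankLeCount_neg_eq_rankGeCount (by omega), rankLeCount_neg_eq_rankGeCount (by omega),
      rankLeCount_neg_eq_rankGeCount (by omega), rankBlock]
    ring
  simp only [h1]
  rw [Finset.sum_comm, rankCount_eq_sum, rankCount_eq_sum, ← Finset.sum_sub_distrib]
  refine Finset.sum_congr rfl fun P _ => ?_
  have h2 : |partitionRank P| ≤ 5 * (J : ℤ) := by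
    have h3 := partition_sup_le P
    have h4 := partition_card_le P
    rw [partitionRank, abs_le]
    omega
  rw [sum_range_indicator, if_pos h2, residueSign]
  rfl

/-! ### Generating functions -/

/-- The generating function of partitions at `q = x ^ 2`. -/
noncomputable def partitionSeries (x : ℂ) : ℂ := ∑' n : ℕ, (partitionFn n : ℂ) * x ^ (2 * n)

/-- The generating function, at `q = x ^ 2`, of nonempty partitions of rank at least `m`. -/
noncomputable def rankSeries (x : ℂ) (m : ℕ) : ℂ :=
  ∑' n : ℕ, (rankGeCount m (n + 1) : ℂ) * x ^ (2 * (n + 1))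

namespace SmallNome

variable {x : ℂ}

lemma norm_mul_pow_le (hx : SmallNome x) {c : ℂ} {n : ℕ} (h : ‖c‖ ≤ 2 ^ n) :
    ‖c * x ^ (2 * n)‖ ≤ (1 / 8) ^ n := by
  have h1 : ‖x‖ ^ 2 ≤ 1 / 16 := by nlinarith [hx.norm_pos, hx.norm_lt]
  rw [norm_mul, norm_pow, pow_mul]
  calc ‖c‖ * (‖x‖ ^ 2) ^ n ≤ 2 ^ n * (1 / 16) ^ n := by gcongr
    _ = (1 / 8) ^ n := by rw [← mul_pow]; norm_num

lemma summable_mul_pow (hx : SmallNome x) {c : ℕ → ℂ} (h : ∀ n, ‖c n‖ ≤ 2 ^ n) :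
    Summable fun n => c n * x ^ (2 * n) :=
  .of_norm_bounded (summable_geometric_of_lt_one (by norm_num) (by norm_num))
    fun n => hx.norm_mul_pow_le (h n)

lemma norm_tsum_mul_pow_le (hx : SmallNome x) {c : ℕ → ℂ} (h : ∀ n, ‖c n‖ ≤ 2 ^ n) :
    ‖∑' n, c n * x ^ (2 * n)‖ ≤ 2 := by
  have h1 := tsum_of_norm_bounded (hasSum_geometric_of_lt_one (r := (1 / 8 : ℝ)) (by norm_num)
    (by norm_num)) fun n => hx.norm_mul_pow_le (h n)
  norm_num at h1
  linarith

end SmallNome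

lemma norm_partitionFn_le (n : ℕ) : ‖(partitionFn n : ℂ)‖ ≤ 2 ^ n := by
  rw [Complex.norm_natCast]
  exact_mod_cast partitionFn_le n

lemma norm_rankGeCount_le (m : ℤ) (n : ℕ) : ‖(rankGeCount m n : ℂ)‖ ≤ 2 ^ n := by
  rw [Complex.norm_natCast]
  exact_mod_cast (rankGeCount_le m n).trans (partitionFn_le n)

namespace SmallNome

variable {x : ℂ}

lemma hasSum_rankSeries (hx : SmallNome x) (m : ℕ) :
    HasSum (fun n : ℕ => (rankGeCount m (n + 1) : ℂ) * x ^ (2 * (n + 1))) (rankSeries x m) :=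
  ((summable_nat_add_iff 1).mpr (hx.summable_mul_pow (norm_rankGeCount_le m))).hasSum

lemma rankSeries_eq_tsum (hx : SmallNome x) {m : ℕ} (hm : 0 < m) :
    rankSeries x m = ∑' n : ℕ, (rankGeCount m n : ℂ) * x ^ (2 * n) := by
  rw [(hx.summable_mul_pow (norm_rankGeCount_le m)).tsum_eq_zero_add,
    rankGeCount_eq_zero (by exact_mod_cast hm) (by positivity), rankSeries]
  simp

lemma norm_rankSeries_le (hx : SmallNome x) {m : ℕ} (hm : 0 < m) : ‖rankSeries x m‖ ≤ 2 := by
  rw [hx.rankSeries_eq_tsum hm]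
  exact hx.norm_tsum_mul_pow_le (norm_rankGeCount_le m)

lemma rankSeries_add (hx : SmallNome x) (m : ℕ) :
    rankSeries x m + x ^ (2 * (m + 1)) * rankSeries x (m + 3)
      = x ^ (2 * (m + 1)) * partitionSeries x := by
  have h0 : ∑ i ∈ Finset.range m, (rankGeCount m (i + 1) : ℂ) * x ^ (2 * (i + 1)) = 0 :=
    Finset.sum_eq_zero fun i hi => by
      have := Finset.mem_range.mp hi
      rw [rankGeCount_eq_zero (by omega) (by push_cast; omega), Nat.cast_zero, zero_mul]
  have h1 := (hx.hasSum_rankSeries m).summable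
  have h2 := hx.summable_mul_pow (norm_rankGeCount_le (m + 3 : ℕ))
  rw [hx.rankSeries_eq_tsum (Nat.succ_pos _), rankSeries, ← h1.sum_add_tsum_nat_add m, h0,
    zero_add, partitionSeries, ← tsum_mul_left, ← tsum_mul_left,
    ← ((summable_nat_add_iff m).mpr h1).tsum_add (h2.mul_left _)]
  refine tsum_congr fun k => ?_
  rw [← rankGeCount_recurrence (m := m) (n := k + m + 1) (k := k) (by push_cast; ring)]
  push_cast
  ring

lemma rankSeries_eq_sum (hx : SmallNome x) (m K : ℕ) :
    rankSeries x m = ∑ k ∈ Finset.range K,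
        partitionSeries x * ((-1) ^ k * x ^ (3 * ((k : ℤ) + 1) ^ 2 + (2 * m - 1) * (k + 1)))
      + (-1) ^ K * x ^ (3 * (K : ℤ) ^ 2 + (2 * m - 1) * K) * rankSeries x (m + 3 * K) := by
  induction K with
  | zero => simp
  | succ K ih =>
    have h1 := hx.rankSeries_add (m + 3 * K)
    have h2 : x ^ (3 * ((K : ℤ) + 1) ^ 2 + (2 * m - 1) * (K + 1))
        = x ^ (3 * (K : ℤ) ^ 2 + (2 * m - 1) * K) * x ^ (2 * (m + 3 * K + 1)) := by
      rw [← zpow_natCast x (2 * (m + 3 * K + 1)), ← zpow_add₀ hx.ne_zero]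
      congr 1; push_cast; ring
    rw [Finset.sum_range_succ, ih, show m + 3 * (K + 1) = m + 3 * K + 3 by ring]
    push_cast
    rw [h2]
    linear_combination (-1) ^ K * x ^ (3 * (K : ℤ) ^ 2 + (2 * m - 1) * K) * h1

lemma hasSum_rankSeries_partitionSeries (hx : SmallNome x) (m : ℕ) :
    HasSum (fun k : ℕ => partitionSeries x *
      ((-1) ^ k * x ^ (3 * ((k : ℤ) + 1) ^ 2 + (2 * m - 1) * (k + 1)))) (rankSeries x m) := by
  have hρ := summable_geometric_of_lt_one hx.norm_pos.le hx.norm_lt_one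
  have hs : Summable fun k : ℕ => partitionSeries x *
      ((-1) ^ k * x ^ (3 * ((k : ℤ) + 1) ^ 2 + (2 * m - 1) * (k + 1))) := by
    refine Summable.mul_left _ (.of_norm_bounded hρ fun k => ?_)
    have h := hx.norm_zpow_le (e := 3 * ((k : ℤ) + 1) ^ 2 + (2 * m - 1) * (k + 1)) (C := 0)
      (N := k)
      (by nlinarith [mul_nonneg (Nat.cast_nonneg' (α := ℤ) m) (Nat.cast_nonneg' (α := ℤ) k)])
    simpa [norm_mul] using h
  rw [hs.hasSum_iff_tendsto_nat]
  have h0 : Filter.Tendsto (fun K : ℕ => (-1) ^ K * x ^ (3 * (K : ℤ) ^ 2 + (2 * m - 1) * K)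
      * rankSeries x (m + 3 * K)) Filter.atTop (nhds 0) := by
    refine squeeze_zero_norm' (a := fun K : ℕ => ‖x‖ ^ K * 2) ?_ ?_
    · filter_upwards [Filter.eventually_gt_atTop 0] with K hK
      have h := hx.norm_zpow_le (e := 3 * (K : ℤ) ^ 2 + (2 * m - 1) * K) (C := 0) (N := K)
        (by
          have hK' : (1 : ℤ) ≤ K := by exact_mod_cast hK
          nlinarith [mul_nonneg (Nat.cast_nonneg' (α := ℤ) m) (Nat.cast_nonneg' (α := ℤ) K)])
      rw [norm_mul, norm_mul, norm_pow, norm_neg, norm_one, one_pow, one_mul]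
      rw [neg_zero, zpow_zero, one_mul] at h
      gcongr
      exact hx.norm_rankSeries_le (by omega)
    · simpa using (tendsto_pow_atTop_nhds_zero_of_lt_one hx.norm_pos.le hx.norm_lt_one).mul_const 2
  have h1 := (tendsto_const_nhds (x := rankSeries x m)).sub h0
  rw [sub_zero] at h1
  exact h1.congr fun K => sub_eq_of_eq_add (hx.rankSeries_eq_sum m K)

lemma partitionSeries_eq_add (hx : SmallNome x) :
    partitionSeries x = 1 + rankSeries x 1 + rankSeries x 0 := by
  rw [partitionSeries, (hx.summable_mul_pow norm_partitionFn_le).tsum_eq_zero_add, rankSeries,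
    rankSeries, add_assoc,
    ← (hx.hasSum_rankSeries 1).summable.tsum_add (hx.hasSum_rankSeries 0).summable]
  simp only [partitionFn_succ, partitionFn_zero, Nat.cast_add, add_mul]
  simp

/-- Euler's pentagonal number theorem. -/
lemma partitionSeries_mul_tsum_pentagonal (hx : SmallNome x) :
    partitionSeries x * ∑' k : ℤ, (-1 : ℂ) ^ k * x ^ (3 * k ^ 2 + k) = 1 := by
  have h1 := hx.hasSum_rankSeries_partitionSeries 1
  have h0 := hx.hasSum_rankSeries_partitionSeries 0
  have h := HasSum.of_add_one_of_neg_add_one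
    (f := fun k : ℤ => partitionSeries x * ((-1 : ℂ) ^ k * x ^ (3 * k ^ 2 + k)))
    (m := -rankSeries x 1) (m' := -rankSeries x 0)
    (h1.neg.congr_fun fun k => ?_) (h0.neg.congr_fun fun k => ?_)
  · rw [← tsum_mul_left, h.tsum_eq]
    have h2 := hx.partitionSeries_eq_add
    norm_num
    linear_combination h2
  · rw [zpow_add_one₀ (by norm_num), zpow_natCast]
    push_cast
    ring_nf
  · rw [neg_one_zpow_neg, zpow_add_one₀ (by norm_num), zpow_natCast]
    push_cast
    ring_nf

end SmallNome

/-! ### The generating function of the rank differences -/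

lemma rankBlock_eq_zero {j n : ℕ} (h : n ≤ 5 * j + 1) : rankBlock j n = 0 := by
  have h0 {m : ℤ} (hm : 5 * (j : ℤ) + 1 ≤ m) : rankGeCount m n = 0 :=
    rankGeCount_eq_zero (by omega) (by omega)
  rw [rankBlock, h0 (by omega), h0 (by omega), h0 (by omega), h0 (by omega)]
  rfl

lemma norm_rankBlock_mul_pow_le {x : ℂ} (hx : SmallNome x) (n j : ℕ) :
    ‖(rankBlock j (n + 1) : ℂ) * x ^ (2 * (n + 1))‖ ≤ 6 * ((1 / 4) ^ n * (1 / 2) ^ j) := by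
  rcases lt_or_ge n j with h | h
  · rw [rankBlock_eq_zero (by omega), Int.cast_zero, zero_mul, norm_zero]
    positivity
  · have hg (m : ℤ) := hx.norm_mul_pow_le (norm_rankGeCount_le m (n + 1))
    rw [rankBlock]
    push_cast
    calc _ = ‖(rankGeCount (5 * j + 1) (n + 1) : ℂ) * x ^ (2 * (n + 1))
            - 2 * ((rankGeCount (5 * j + 2) (n + 1) : ℂ) * x ^ (2 * (n + 1)))
            + 2 * ((rankGeCount (5 * j + 4) (n + 1) : ℂ) * x ^ (2 * (n + 1)))
            - (rankGeCount (5 * j + 5) (n + 1) : ℂ) * x ^ (2 * (n + 1))‖ := by congr 1; ring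
      _ ≤ (1 / 8) ^ (n + 1) + 2 * (1 / 8) ^ (n + 1) + 2 * (1 / 8) ^ (n + 1)
            + (1 / 8) ^ (n + 1) := by
          refine (norm_sub_le _ _).trans (add_le_add ((norm_add_le _ _).trans
            (add_le_add ((norm_sub_le _ _).trans (add_le_add (hg _) ?_)) ?_)) (hg _)) <;>
          · rw [norm_mul, Complex.norm_ofNat]
            exact mul_le_mul_of_nonneg_left (hg _) (by norm_num)
      _ = 6 / 8 * ((1 / 4) ^ n * (1 / 2) ^ n) := by rw [← mul_pow]; norm_num; ring
      _ ≤ 6 * ((1 / 4) ^ n * (1 / 2) ^ j) := by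
          gcongr ?_ * (_ * ?_)
          · norm_num
          · exact pow_le_pow_of_le_one (by norm_num) (by norm_num) h

/-- The general term of the double series for the rank differences. -/
noncomputable def rankBlockTerm (x : ℂ) (j k : ℕ) : ℂ :=
  (-1) ^ k * x ^ (3 * (k + 1) ^ 2 + (10 * j + 1) * (k + 1))
    * (1 - 2 * x ^ (2 * (k + 1)) + 2 * x ^ (6 * (k + 1)) - x ^ (8 * (k + 1)))

namespace SmallNome

variable {x : ℂ}

lemma hasSum_rankBlock (hx : SmallNome x) (j : ℕ) :
    HasSum (fun n : ℕ => (rankBlock j (n + 1) : ℂ) * x ^ (2 * (n + 1)))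
      (partitionSeries x * ∑' k, rankBlockTerm x j k) := by
  have h1 := (((hx.hasSum_rankSeries (5 * j + 1)).sub
    ((hx.hasSum_rankSeries (5 * j + 2)).mul_left 2)).add
    ((hx.hasSum_rankSeries (5 * j + 4)).mul_left 2)).sub (hx.hasSum_rankSeries (5 * j + 5))
  have h2 := (((hx.hasSum_rankSeries_partitionSeries (5 * j + 1)).sub
    ((hx.hasSum_rankSeries_partitionSeries (5 * j + 2)).mul_left 2)).add
    ((hx.hasSum_rankSeries_partitionSeries (5 * j + 4)).mul_left 2)).sub
    (hx.hasSum_rankSeries_partitionSeries (5 * j + 5))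
  have h3 : partitionSeries x * ∑' k, rankBlockTerm x j k = rankSeries x (5 * j + 1)
      - 2 * rankSeries x (5 * j + 2) + 2 * rankSeries x (5 * j + 4) - rankSeries x (5 * j + 5) := by
    rw [← h2.tsum_eq, ← tsum_mul_left]
    refine tsum_congr fun k => ?_
    have e (c : ℕ) : x ^ (3 * ((k : ℤ) + 1) ^ 2 + (2 * ((5 * j + (c + 1) : ℕ) : ℤ) - 1) * (k + 1))
        = x ^ (3 * (k + 1) ^ 2 + (10 * j + 1) * (k + 1)) * x ^ (2 * c * (k + 1)) := by
      rw [← pow_add, ← zpow_natCast]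
      congr 1; push_cast; ring
    rw [e 0, e 1, e 3, e 4, rankBlockTerm]
    norm_num
    ring
  rw [h3]
  refine h1.congr_fun fun n => ?_
  rw [rankBlock]
  push_cast
  ring

lemma summable_rankBlockTerm (hx : SmallNome x) :
    Summable fun p : ℕ × ℕ => rankBlockTerm x p.1 p.2 := by
  have hρ := summable_geometric_of_lt_one hx.norm_pos.le hx.norm_lt_one
  refine Summable.of_norm_bounded ((hρ.mul_of_nonneg hρ (fun _ => by positivity)
    fun _ => by positivity).mul_left 6) fun p => ?_
  obtain ⟨j, k⟩ := p
  have h1 (n : ℕ) : ‖x ^ n‖ ≤ 1 := by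
    rw [norm_pow]; exact pow_le_one₀ (norm_nonneg _) hx.norm_lt_one.le
  have h2 : ‖x ^ (3 * (k + 1) ^ 2 + (10 * j + 1) * (k + 1))‖ ≤ ‖x‖ ^ j * ‖x‖ ^ k := by
    rw [norm_pow, ← pow_add]
    exact pow_le_pow_of_le_one hx.norm_pos.le hx.norm_lt_one.le (by nlinarith)
  have h3 : ‖1 - 2 * x ^ (2 * (k + 1)) + 2 * x ^ (6 * (k + 1)) - x ^ (8 * (k + 1))‖
      ≤ 1 + 2 * 1 + 2 * 1 + 1 := by
    refine (norm_sub_le _ _).trans (add_le_add ((norm_add_le _ _).trans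
      (add_le_add ((norm_sub_le _ _).trans (add_le_add norm_one.le ?_)) ?_)) (h1 _)) <;>
    · rw [norm_mul, Complex.norm_ofNat]
      exact mul_le_mul_of_nonneg_left (h1 _) (by norm_num)
  rw [rankBlockTerm, norm_mul, norm_mul, norm_pow, norm_neg, norm_one, one_pow, one_mul]
  calc _ ≤ ‖x‖ ^ j * ‖x‖ ^ k * (1 + 2 * 1 + 2 * 1 + 1) := by gcongr
    _ = 6 * (‖x‖ ^ j * ‖x‖ ^ k) := by ring

lemma tsum_rankBlockTerm (hx : SmallNome x) (k : ℕ) :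
    ∑' j, rankBlockTerm x j k = (2 * lambertTerm x 1 (k + 1) + lambertTerm x 4 (k + 1))
      + (2 * lambertTerm x 1 (-(k + 1)) + lambertTerm x 4 (-(k + 1))) := by
  have h1 : ‖x ^ (10 * (k + 1))‖ < 1 := by
    rw [norm_pow]; exact pow_lt_one₀ (norm_nonneg _) hx.norm_lt_one (by omega)
  have h2 : ∑' j, rankBlockTerm x j k = (-1) ^ k * x ^ (3 * (k + 1) ^ 2 + (k + 1))
      * (1 - 2 * x ^ (2 * (k + 1)) + 2 * x ^ (6 * (k + 1)) - x ^ (8 * (k + 1)))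
      * (1 - x ^ (10 * (k + 1)))⁻¹ := by
    rw [← tsum_geometric_of_norm_lt_one h1, ← tsum_mul_left]
    refine tsum_congr fun j => ?_
    rw [rankBlockTerm]
    ring
  have hp (d : ℕ) : x ^ (3 * (k + 1) ^ 2) * (x ^ (k + 1)) ^ d
      = x ^ (3 * ((k : ℤ) + 1) ^ 2 + d * (k + 1)) := by
    rw [← pow_mul, ← pow_add, ← zpow_natCast]
    congr 1; push_cast; ring
  have h10 : x ^ (10 * ((k : ℤ) + 1)) = (x ^ (k + 1)) ^ 10 := by
    rw [← pow_mul, ← zpow_natCast]; congr 1; push_cast; ring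
  have hn (c : ℤ) (d : ℕ) (h : c * (k + 1) + 10 * (k + 1) = d * (k + 1)) :
      x ^ (3 * ((k : ℤ) + 1) ^ 2 + c * (k + 1)) * (x ^ (k + 1)) ^ 10
        = x ^ (3 * (k + 1) ^ 2) * (x ^ (k + 1)) ^ d := by
    rw [hp, ← h10, ← zpow_add₀ hx.ne_zero, add_assoc, h]
  have n1 := hn (-3) 7 (by push_cast; ring)
  have n4 := hn (-9) 1 (by push_cast; ring)
  have p1 := hp 3
  have p4 := hp 9
  have hs : (-1 : ℂ) ^ ((k : ℤ) + 1) = -(-1) ^ k := by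
    rw [zpow_add_one₀ (by norm_num), zpow_natCast]; ring
  rw [h2, lambertTerm, lambertTerm, lambertTerm, lambertTerm, mul_neg 10 ((k : ℤ) + 1),
    hx.inv_one_sub_zpow_neg, neg_one_zpow_neg, hs, neg_sq, h10]
  push_cast at p1 p4
  norm_num only [mul_neg, ← neg_mul]
  rw [← p1, ← p4, pow_add x, pow_mul' x 2, pow_mul' x 6, pow_mul' x 8, pow_mul' x 10]
  linear_combination (-(-1) ^ k * (1 - (x ^ (k + 1)) ^ 10)⁻¹) * (2 * n1 + n4)

lemma tsum_tsum_rankBlockTerm (hx : SmallNome x) :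
    ∑' (k : ℕ) (j : ℕ), rankBlockTerm x j k
      = 2 * ∑' k, lambertTerm x 1 k + ∑' k, lambertTerm x 4 k := by
  have h : HasSum (fun k : ℤ => 2 * lambertTerm x 1 k + lambertTerm x 4 k)
      (2 * ∑' k, lambertTerm x 1 k + ∑' k, lambertTerm x 4 k) :=
    ((hx.summable_lambertTerm 1).of_norm.hasSum.mul_left 2).add
      (hx.summable_lambertTerm 4).of_norm.hasSum
  have h0 : 2 * lambertTerm x 1 0 + lambertTerm x 4 0 = 0 := by simp [lambertTerm]
  have h1 := h.nat_add_neg.summable.tsum_eq_zero_add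
  rw [h.nat_add_neg.tsum_eq] at h1
  simp only [Nat.cast_zero, neg_zero, h0, add_zero, zero_add, Nat.cast_add, Nat.cast_one] at h1
  rw [h1]
  exact tsum_congr hx.tsum_rankBlockTerm

lemma summable_rankBlock (hx : SmallNome x) :
    Summable fun p : ℕ × ℕ => (rankBlock p.2 (p.1 + 1) : ℂ) * x ^ (2 * (p.1 + 1)) := by
  have h4 : Summable fun n : ℕ => (1 / 4 : ℝ) ^ n :=
    summable_geometric_of_lt_one (by norm_num) (by norm_num)
  have h2 : Summable fun n : ℕ => (1 / 2 : ℝ) ^ n :=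
    summable_geometric_of_lt_one (by norm_num) (by norm_num)
  exact .of_norm_bounded ((h4.mul_of_nonneg h2 (fun _ => by positivity)
    fun _ => by positivity).mul_left 6) fun p => norm_rankBlock_mul_pow_le hx p.1 p.2

lemma tsum_tsum_rankBlock (hx : SmallNome x) :
    ∑' (n : ℕ) (j : ℕ), (rankBlock j (n + 1) : ℂ) * x ^ (2 * (n + 1))
      = rankPartZero x + rankPartFour x + rankPartOne x := by
  calc _ = ∑' (j : ℕ) (n : ℕ), (rankBlock j (n + 1) : ℂ) * x ^ (2 * (n + 1)) :=
        (Summable.tsum_comm (f := fun n j : ℕ =>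
          (rankBlock j (n + 1) : ℂ) * x ^ (2 * (n + 1))) hx.summable_rankBlock).symm
    _ = ∑' (j : ℕ), partitionSeries x * ∑' k, rankBlockTerm x j k :=
        tsum_congr fun j => (hx.hasSum_rankBlock j).tsum_eq
    _ = partitionSeries x * ∑' (k : ℕ) (j : ℕ), rankBlockTerm x j k := by
        rw [tsum_mul_left, Summable.tsum_comm (f := rankBlockTerm x) hx.summable_rankBlockTerm]
    _ = _ := by
        rw [hx.tsum_tsum_rankBlockTerm, ← hx.tsum_pentagonal_mul_rankParts, ← mul_assoc,
          hx.partitionSeries_mul_tsum_pentagonal, one_mul]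

lemma rankCount_sub_mul_pow (x : ℂ) (n : ℕ) :
    ((rankCount 1 5 n : ℂ) - rankCount 2 5 n) * x ^ (2 * n)
      = ∑' j, (rankBlock j n : ℂ) * x ^ (2 * n) := by
  have h := rankCount_sub_rankCount (le_refl n)
  rw [tsum_mul_right, tsum_eq_sum (s := Finset.range n) fun j hj => ?_]
  · congr 1
    exact_mod_cast h
  · have hj := Finset.mem_range.not.mp hj
    rw [rankBlock_eq_zero (by omega), Int.cast_zero]

/-- The dissected generating function of the differences of rank counts. -/
lemma hasSum_rankCount_sub (hx : SmallNome x) :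
    HasSum (fun n : ℕ => ((rankCount 1 5 n : ℂ) - rankCount 2 5 n) * x ^ (2 * n))
      (rankPartZero x + rankPartFour x + rankPartOne x) := by
  have h0 : ((rankCount 1 5 0 : ℂ) - rankCount 2 5 0) * x ^ (2 * 0) = 0 := by
    rw [rankCount_sub_mul_pow]
    simp [rankBlock_eq_zero]
  have h1 : HasSum (fun n : ℕ => ((rankCount 1 5 (n + 1) : ℂ) - rankCount 2 5 (n + 1))
      * x ^ (2 * (n + 1))) (rankPartZero x + rankPartFour x + rankPartOne x) := by
    simp only [rankCount_sub_mul_pow]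
    rw [← hx.tsum_tsum_rankBlock]
    exact hx.summable_rankBlock.prod.hasSum
  rw [← zero_add (rankPartZero x + _ + _), ← h0]
  exact HasSum.zero_add (f := fun n : ℕ =>
    ((rankCount 1 5 n : ℂ) - rankCount 2 5 n) * x ^ (2 * n)) h1

end SmallNome

/-! ### Extraction of a residue class -/

lemma SmallNome.root_mul {w x : ℂ} (hx : SmallNome x) (hw : w ^ 5 = 1) : SmallNome (w * x) where
  ne_zero := mul_ne_zero (by rintro rfl; norm_num at hw) hx.ne_zero
  norm_lt := by
    rw [norm_mul, Complex.norm_eq_one_of_pow_eq_one hw (by norm_num), one_mul]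
    exact hx.norm_lt

/-- The rank difference series, filtered by a fifth root of unity, vanishes. -/
lemma SmallNome.hasSum_rankCount_sub_filter {x w : ℂ} (hx : SmallNome x)
    (hw : IsPrimitiveRoot w 5) :
    HasSum (fun n : ℕ => (x ^ 2) ^ n * (((rankCount 1 5 n : ℂ) - rankCount 2 5 n)
      * ∑ i ∈ Finset.range 5, (w ^ (2 * n + 3)) ^ i)) 0 := by
  have h5 (i : ℕ) : (w ^ i) ^ 5 = 1 := by rw [← pow_mul, mul_comm, pow_mul, hw.pow_eq_one, one_pow]
  have hg {a : ℕ} (ha : a.Coprime 5) : ∑ i ∈ Finset.range 5, (w ^ a) ^ i = 0 :=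
    (hw.pow_of_coprime a ha).geom_sum_eq_zero (by norm_num)
  have h := hasSum_sum (s := Finset.range 5) fun i _ =>
    (hx.root_mul (h5 i)).hasSum_rankCount_sub.mul_left ((w ^ i) ^ 3)
  have h0 : ∑ i ∈ Finset.range 5, (w ^ i) ^ 3 * (rankPartZero (w ^ i * x)
      + rankPartFour (w ^ i * x) + rankPartOne (w ^ i * x)) = 0 := by
    have h3 := hg (a := 3) (by norm_num)
    have h4 := hg (a := 4) (by norm_num)
    have h7 := hg (a := 7) (by norm_num)
    simp only [rankPartZero_rotate (h5 _), rankPartFour_rotate (h5 _), rankPartOne_rotate (h5 _)]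
    simp only [Finset.sum_range_succ, Finset.sum_range_zero] at h3 h4 h7 ⊢
    linear_combination rankPartZero x * h3 + rankPartFour x * h7 + rankPartOne x * h4
  rw [h0] at h
  refine h.congr_fun fun n => ?_
  rw [Finset.mul_sum, Finset.mul_sum]
  refine Finset.sum_congr rfl fun i _ => ?_
  rw [mul_pow]
  ring

lemma eq_zero_of_eventually_hasSum {c : ℕ → ℂ}
    (h : ∀ᶠ z in nhds (0 : ℂ), HasSum (fun n => z ^ n * c n) 0) (n : ℕ) : c n = 0 := by
  have h1 : HasFPowerSeriesAt (0 : ℂ → ℂ) (FormalMultilinearSeries.ofScalars ℂ c) 0 := by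
    rw [hasFPowerSeriesAt_iff]
    filter_upwards [h] with z hz
    simpa [FormalMultilinearSeries.coeff_ofScalars] using hz
  rw [← FormalMultilinearSeries.coeff_ofScalars (𝕜 := ℂ) (p := c), h1.eq_zero]
  simp [FormalMultilinearSeries.coeff]

lemma rankCount_sub_mul_sum_eq_zero {w : ℂ} (hw : IsPrimitiveRoot w 5) (n : ℕ) :
    ((rankCount 1 5 n : ℂ) - rankCount 2 5 n)
      * ∑ i ∈ Finset.range 5, (w ^ (2 * n + 3)) ^ i = 0 := by
  refine eq_zero_of_eventually_hasSum (c := fun n : ℕ => ((rankCount 1 5 n : ℂ) - rankCount 2 5 n)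
      * ∑ i ∈ Finset.range 5, (w ^ (2 * n + 3)) ^ i) ?_ n
  filter_upwards [Metric.ball_mem_nhds (0 : ℂ) (by norm_num : (0 : ℝ) < 1 / 16)] with z hz
  rcases eq_or_ne z 0 with rfl | hz0
  · have h := hasSum_single (f := fun n : ℕ => (0 : ℂ) ^ n * (((rankCount 1 5 n : ℂ)
      - rankCount 2 5 n) * ∑ i ∈ Finset.range 5, (w ^ (2 * n + 3)) ^ i)) 0
      fun n hn => by simp [hn]
    have h3 := hw.pow_of_coprime 3 (by norm_num)
    simpa [h3.geom_sum_eq_zero (by norm_num)] using h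
  · obtain ⟨x, rfl⟩ := IsAlgClosed.exists_pow_nat_eq z (n := 2) (by norm_num)
    refine SmallNome.hasSum_rankCount_sub_filter ⟨by rintro rfl; norm_num at hz0, ?_⟩ hw
    rw [mem_ball_zero_iff, norm_pow] at hz
    nlinarith [norm_nonneg x]

theorem dyson_5_1 (n : ℕ) : rankCount 1 5 (5 * n + 1) = rankCount 2 5 (5 * n + 1) := by
  have hw := Complex.isPrimitiveRoot_exp 5 (by norm_num)
  have h := rankCount_sub_mul_sum_eq_zero hw (5 * n + 1)
  rw [show 2 * (5 * n + 1) + 3 = 5 * (2 * n + 1) by ring, pow_mul, hw.pow_eq_one] at h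
  simp only [one_pow, Finset.sum_const, Finset.card_range, nsmul_eq_mul, mul_one] at h
  exact_mod_cast sub_eq_zero.mp ((mul_eq_zero.mp h).resolve_right (by norm_num))
end
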